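/- arXiv:1411.4640 — 2 statements merged into one kernel-verified Lean document; each statement's English description precedes it below -/
import Mathlib

section
/- Let M ⊂ ℝ³ be a properly embedded surface such that the surfaces M_t = √(−t) · M, t ∈ [−1, 0), form a mean curvature flow (i.e. M is a self-shrinker), and suppose area(M ∩ {|x| ≤ 4}) < ∞. Then for every k ≥ 1, area(M ∩ {|x| ≤ 2k}) ≤ 8k² · area(M ∩ {|x| ≤ 4}). In particular, M has at most quadratic (hence polynomial) area growth. -/
open scoped RealInnerProductSpace
open MeasureTheory
noncomputable section

abbrev E3 := EuclideanSpace ℝ (Fin 3)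

/-- A smoothly embedded surface in `ℝ³`, given locally as the regular zero set of a
smooth defining function, together with the unit normal `ν` (the normalized gradient
of the local defining function, extended to a neighborhood). -/
structure Surface3 where
  carrier : Set E3
  ν : E3 → E3
  localDef : ∀ p ∈ carrier, ∃ U : Set E3, IsOpen U ∧ p ∈ U ∧ ∃ f : E3 → ℝ,
    ContDiffOn ℝ (⊤ : ℕ∞) f U ∧ (∀ x ∈ U, (x ∈ carrier ↔ f x = 0)) ∧
    ∀ x ∈ U, gradient f x ≠ 0 ∧ ν x = ‖gradient f x‖⁻¹ • gradient f x

/-- The mean curvature of a surface, computed as the (ambient) divergence of the unit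
normal extension; since `ν` has unit length near the surface this agrees with the
tangential divergence, i.e. the trace of the second fundamental form. -/
def meanCurv (S : Surface3) (p : E3) : ℝ :=
  ∑ i : Fin 3, ⟪fderiv ℝ S.ν p (EuclideanSpace.single i 1), EuclideanSpace.single i 1⟫

/-- The self-shrinker equation `H = ½⟨x, ν⟩`. -/
def IsShrinker (S : Surface3) : Prop :=
  ∀ p ∈ S.carrier, meanCurv S p = (1/2) * ⟪p, S.ν p⟫

/-- A measure inequality may be checked locally. -/
lemma measure_le_of_locally_le {X : Type*} [TopologicalSpace X] [SecondCountableTopology X]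
    [MeasurableSpace X] [OpensMeasurableSpace X] {m n : Measure X} {V : Set X}
    (hV : MeasurableSet V) (hm : m Vᶜ = 0)
    (h : ∀ q ∈ V, ∃ O ∈ nhds q, ∀ s ⊆ O ∩ V, MeasurableSet s → m s ≤ n s) : m ≤ n := by
  classical
  choose! O hO hle using h
  obtain ⟨t, htV, htc, hcov⟩ := TopologicalSpace.countable_cover_nhdsWithin
    (f := fun q => interior (O q)) (s := V)
    (fun q hq => mem_nhdsWithin_of_mem_nhds (interior_mem_nhds.2 (hO q hq)))
  refine Measure.le_iff.2 fun s hs => ?_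
  have hsV : m s = m (s ∩ V) := by
    refine le_antisymm ?_ (measure_mono Set.inter_subset_left)
    calc m s ≤ m ((s ∩ V) ∪ Vᶜ) := measure_mono fun x hx => by
            by_cases hxV : x ∈ V
            · exact Or.inl ⟨hx, hxV⟩
            · exact Or.inr hxV
      _ ≤ m (s ∩ V) + m Vᶜ := measure_union_le _ _
      _ = m (s ∩ V) := by rw [hm, add_zero]
  rw [hsV]
  refine le_trans ?_ (measure_mono (Set.inter_subset_left : s ∩ V ⊆ s))
  have hsVm := hs.inter hV
  rcases t.eq_empty_or_nonempty with rfl | hne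
  · have : V = ∅ := by simpa using hcov
    simp [this]
  obtain ⟨e, rfl⟩ := htc.exists_eq_range hne
  let D : ℕ → Set X := disjointed fun i => interior (O (e i))
  have hDm : ∀ i, MeasurableSet (D i) :=
    MeasurableSet.disjointed fun i => isOpen_interior.measurableSet
  have hsplit : s ∩ V = ⋃ i, (s ∩ V ∩ D i) := by
    rw [← Set.inter_iUnion, eq_comm, Set.inter_eq_left, iUnion_disjointed]
    intro x hx
    simpa using hcov hx.2
  have hdisj : Pairwise (Function.onFun Disjoint fun i => s ∩ V ∩ D i) := fun i j hij =>
    (disjoint_disjointed _ hij).mono Set.inter_subset_right Set.inter_subset_right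
  rw [hsplit, measure_iUnion hdisj fun i => hsVm.inter (hDm i),
    measure_iUnion hdisj fun i => hsVm.inter (hDm i)]
  refine ENNReal.tsum_le_tsum fun i => hle (e i) (htV ⟨i, rfl⟩) _ ?_ (hsVm.inter (hDm i))
  exact fun x hx => ⟨interior_subset (disjointed_subset (fun i => interior (O (e i))) i hx.2), hx.1.2⟩

/-- The plane, as the parameter space for local graph charts. -/
abbrev E2 := EuclideanSpace ℝ (Fin 2)

/-- A linear automorphism of the plane inducing the metric of a graph with slopes `r₀`, `r₁`. -/
lemma exists_graph_metric_root (r₀ r₁ : ℝ) : ∃ B : E2 →ₗ[ℝ] E2,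
    (∀ v, ‖B v‖ ^ 2 = v 0 ^ 2 + v 1 ^ 2 + (r₀ * v 0 + r₁ * v 1) ^ 2) ∧
    |LinearMap.det B| = √(1 + r₀ ^ 2 + r₁ ^ 2) := by
  set s := √(1 + r₀ ^ 2) with hs
  set W := √(1 + r₀ ^ 2 + r₁ ^ 2) with hW
  have hs0 : 0 < s := Real.sqrt_pos.2 (by positivity)
  have hW0 : 0 < W := Real.sqrt_pos.2 (by positivity)
  have hs2 : s ^ 2 = 1 + r₀ ^ 2 := Real.sq_sqrt (by positivity)
  have hW2 : W ^ 2 = 1 + r₀ ^ 2 + r₁ ^ 2 := Real.sq_sqrt (by positivity)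
  refine ⟨Matrix.toLpLin 2 2 !![s, r₀ * r₁ / s; 0, W / s], fun v => ?_, ?_⟩
  · rw [EuclideanSpace.norm_sq_eq]
    simp [Fin.sum_univ_two, Matrix.toLpLin_apply, dotProduct]
    field_simp
    linear_combination (s ^ 2 * v 0 ^ 2 + 2 * r₀ * r₁ * v 0 * v 1 - v 0 ^ 2 - (r₀ * v 0 + r₁ * v 1) ^ 2 - v 1 ^ 2 + v 0 ^ 2 * (1 + r₀ ^ 2)) * hs2 + v 1 ^ 2 * hW2
  · have : LinearMap.det (Matrix.toLpLin 2 2 !![s, r₀ * r₁ / s; 0, W / s] : E2 →ₗ[ℝ] E2) = W := by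
      rw [Matrix.toLpLin_eq_toLin, LinearMap.det_toLin, Matrix.det_fin_two]
      simp
      field_simp
    rw [this, abs_of_pos hW0]

/-- The coordinates of a point in the plane spanned by the first two vectors of a basis. -/
def graphProj (b : OrthonormalBasis (Fin 3) ℝ E3) : E3 →L[ℝ] E2 :=
  (EuclideanSpace.equiv (Fin 2) ℝ).symm.toContinuousLinearMap ∘L
    ContinuousLinearMap.pi fun j => innerSL ℝ (b j.castSucc)

@[simp] lemma graphProj_apply (b : OrthonormalBasis (Fin 3) ℝ E3) (x : E3) (j : Fin 2) :
    graphProj b x j = ⟪b j.castSucc, x⟫ := rfl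

/-- The lift of a vector of the parameter plane to the plane orthogonal to `n`. -/
def graphDeriv (b : OrthonormalBasis (Fin 3) ℝ E3) (n : E3) : E2 →L[ℝ] E3 :=
  LinearMap.toContinuousLinearMap
    { toFun := fun v => v 0 • b 0 + v 1 • b 1
        - ((⟪n, b 0⟫ * v 0 + ⟪n, b 1⟫ * v 1) / ⟪n, b 2⟫) • b 2
      map_add' := fun v w => by
        simp only [PiLp.add_apply]
        module
      map_smul' := fun c v => by
        simp only [PiLp.smul_apply, smul_eq_mul, RingHom.id_apply]
        module }

lemma graphDeriv_apply (b : OrthonormalBasis (Fin 3) ℝ E3) (n : E3) (v : E2) :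
    graphDeriv b n v = v 0 • b 0 + v 1 • b 1
        - ((⟪n, b 0⟫ * v 0 + ⟪n, b 1⟫ * v 1) / ⟪n, b 2⟫) • b 2 := rfl

lemma inner_eq_sum_three (b : OrthonormalBasis (Fin 3) ℝ E3) (x y : E3) :
    ⟪x, y⟫ = ⟪x, b 0⟫ * ⟪y, b 0⟫ + ⟪x, b 1⟫ * ⟪y, b 1⟫ + ⟪x, b 2⟫ * ⟪y, b 2⟫ := by
  rw [← b.sum_inner_mul_inner x y, Fin.sum_univ_three]
  simp only [real_inner_comm]

lemma norm_graphDeriv_sq (b : OrthonormalBasis (Fin 3) ℝ E3) (n : E3) (v : E2) :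
    ‖graphDeriv b n v‖ ^ 2 = v 0 ^ 2 + v 1 ^ 2
      + (⟪n, b 0⟫ / ⟪n, b 2⟫ * v 0 + ⟪n, b 1⟫ / ⟪n, b 2⟫ * v 1) ^ 2 := by
  rw [← real_inner_self_eq_norm_sq, inner_eq_sum_three b, graphDeriv_apply]
  simp [inner_add_left, inner_sub_left, inner_smul_left]
  ring

lemma inner_graphDeriv (b : OrthonormalBasis (Fin 3) ℝ E3) {n : E3} (hn : ⟪n, b 2⟫ ≠ 0) (v : E2) :
    ⟪n, graphDeriv b n v⟫ = 0 := by
  rw [graphDeriv_apply]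
  simp only [inner_add_right, inner_sub_right, inner_smul_right]
  field_simp
  ring

lemma graphProj_graphDeriv (b : OrthonormalBasis (Fin 3) ℝ E3) (n : E3) (v : E2) :
    graphProj b (graphDeriv b n v) = v := by
  ext j
  rw [graphProj_apply, graphDeriv_apply]
  fin_cases j <;>
    simp [inner_add_right, inner_sub_right, inner_smul_right]

/-- A local description of a surface as a graph over a plane, on an open set where the normal
field is smooth and has the derivative symmetries of a normalized gradient. -/
structure GraphChart (S : Surface3) where
  b : OrthonormalBasis (Fin 3) ℝ E3
  U : Set E3
  V : Set E2
  g : E2 → E3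
  isOpen_U : IsOpen U
  isOpen_V : IsOpen V
  g_mem : ∀ y ∈ V, g y ∈ S.carrier ∩ U
  proj_g : ∀ y ∈ V, graphProj b (g y) = y
  proj_mem : ∀ x ∈ S.carrier ∩ U, graphProj b x ∈ V
  g_proj : ∀ x ∈ S.carrier ∩ U, g (graphProj b x) = x
  normal_pos : ∀ x ∈ U, 0 < ⟪S.ν x, b 2⟫
  normal_norm : ∀ x ∈ U, ‖S.ν x‖ = 1
  normal_smooth : ContDiffOn ℝ (⊤ : ℕ∞) S.ν U
  normal_symm : ∀ x ∈ U, ∃ α : E3 →L[ℝ] ℝ, ∀ v w,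
    ⟪fderiv ℝ S.ν x v, w⟫ - ⟪fderiv ℝ S.ν x w, v⟫ = ⟪S.ν x, w⟫ * α v - ⟪S.ν x, v⟫ * α w
  hasStrictFDerivAt : ∀ y ∈ V, HasStrictFDerivAt g (graphDeriv b (S.ν (g y))) y

namespace GraphChart

variable {S : Surface3} (c : GraphChart S)

/-- The density of surface area in a graph chart. -/
def jac (y : E2) : ℝ := 1 / ⟪S.ν (c.g y), c.b 2⟫

lemma continuousOn_g : ContinuousOn c.g c.V := fun y hy =>
  (c.hasStrictFDerivAt y hy).hasFDerivAt.continuousAt.continuousWithinAt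

lemma continuousOn_normal_g : ContinuousOn (fun y => S.ν (c.g y)) c.V :=
  c.normal_smooth.continuousOn.comp c.continuousOn_g fun y hy => (c.g_mem y hy).2

lemma jac_pos {y : E2} (hy : y ∈ c.V) : 0 < c.jac y :=
  one_div_pos.2 (c.normal_pos _ (c.g_mem y hy).2)

lemma continuousOn_jac : ContinuousOn c.jac c.V :=
  continuousOn_const.div (c.continuousOn_normal_g.inner continuousOn_const)
    fun y hy => (c.normal_pos _ (c.g_mem y hy).2).ne'

lemma image_eq {s : Set E2} (hs : s ⊆ c.V) :
    graphProj c.b ⁻¹' s ∩ (S.carrier ∩ c.U) = c.g '' s := by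
  ext x
  constructor
  · rintro ⟨hx, hxU⟩
    exact ⟨_, hx, c.g_proj x hxU⟩
  · rintro ⟨y, hy, rfl⟩
    refine ⟨?_, c.g_mem y (hs hy)⟩
    rwa [Set.mem_preimage, c.proj_g y (hs hy)]

/-- Near each parameter, the chart distorts distances like an explicit linear map. -/
lemma exists_linear_approx {q : E2} (hq : q ∈ c.V) : ∃ B : E2 →ₗ[ℝ] E2,
    |LinearMap.det B| = c.jac q ∧ (∀ v, ‖v‖ ≤ ‖B v‖) ∧
    ∀ δ > 0, ∃ O ∈ nhds q, ∀ y ∈ O, ∀ z ∈ O,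
      |‖c.g y - c.g z‖ - ‖B y - B z‖| ≤ δ * ‖B y - B z‖ := by
  set n := S.ν (c.g q) with hn
  have hn2 : 0 < ⟪n, c.b 2⟫ := c.normal_pos _ (c.g_mem q hq).2
  obtain ⟨B, hB, hdet⟩ := exists_graph_metric_root (⟪n, c.b 0⟫ / ⟪n, c.b 2⟫) (⟪n, c.b 1⟫ / ⟪n, c.b 2⟫)
  have hBn : ∀ v, ‖B v‖ = ‖graphDeriv c.b n v‖ := fun v =>
    (sq_eq_sq₀ (norm_nonneg _) (norm_nonneg _)).1 ((hB v).trans (norm_graphDeriv_sq c.b n v).symm)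
  have hBge : ∀ v, ‖v‖ ≤ ‖B v‖ := fun v => by
    refine (sq_le_sq₀ (norm_nonneg _) (norm_nonneg _)).1 ?_
    rw [hB, EuclideanSpace.norm_sq_eq, Fin.sum_univ_two]
    simp only [Real.norm_eq_abs, sq_abs]
    nlinarith [sq_nonneg (⟪n, c.b 0⟫ / ⟪n, c.b 2⟫ * v 0 + ⟪n, c.b 1⟫ / ⟪n, c.b 2⟫ * v 1)]
  refine ⟨B, ?_, hBge, fun δ hδ => ?_⟩
  · have h1 : ⟪n, n⟫ = 1 := by
      rw [real_inner_self_eq_norm_sq, c.normal_norm _ (c.g_mem q hq).2, one_pow]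
    rw [inner_eq_sum_three c.b] at h1
    rw [hdet, jac, ← hn, Real.sqrt_eq_iff_mul_self_eq_of_pos (by positivity)]
    field_simp
    linear_combination -h1
  · have h := (c.hasStrictFDerivAt q hq).isLittleO.def hδ
    have hmem : {p : E2 × E2 | ‖c.g p.1 - c.g p.2 - graphDeriv c.b n (p.1 - p.2)‖
        ≤ δ * ‖p.1 - p.2‖} ∈ nhds q ×ˢ nhds q := by
      rw [← nhds_prod_eq]
      exact h
    obtain ⟨O, hO, hOO⟩ := Filter.mem_prod_self_iff.1 hmem
    refine ⟨O, hO, fun y hy z hz => ?_⟩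
    rw [← map_sub, hBn]
    calc _ ≤ ‖c.g y - c.g z - graphDeriv c.b n (y - z)‖ := abs_norm_sub_norm_le _ _
      _ ≤ δ * ‖y - z‖ := by
          have := hOO (Set.mk_mem_prod hy hz)
          simpa only [Set.mem_ofPred_eq] using this
      _ ≤ _ := by rw [← hBn]; gcongr; exact hBge _

end GraphChart

instance isAddHaarMeasure_hausdorffMeasure_plane :
    Measure.IsAddHaarMeasure (μH[2] : Measure E2) := by
  simpa using isAddHaarMeasure_hausdorffMeasure (E := E2)

/-- Comparing distances compares Hausdorff measures of images. -/
lemma hausdorffMeasure_image_le_image {X Y Z : Type*}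
    [MetricSpace Y] [MeasurableSpace Y] [BorelSpace Y]
    [MetricSpace Z] [MeasurableSpace Z] [BorelSpace Z] {φ : X → Y} {ψ : X → Z} {s : Set X}
    {C : NNReal} (h : ∀ y ∈ s, ∀ z ∈ s, dist (φ y) (φ z) ≤ C * dist (ψ y) (ψ z)) :
    μH[2] (φ '' s) ≤ (C : ENNReal) ^ 2 * μH[2] (ψ '' s) := by
  rcases s.eq_empty_or_nonempty with rfl | ⟨x₀, -⟩
  · simp
  have : Nonempty X := ⟨x₀⟩
  have hinv : ∀ y ∈ s, φ (Function.invFunOn ψ s (ψ y)) = φ y := fun y hy => by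
    have hex : ∃ a ∈ s, ψ a = ψ y := ⟨y, hy, rfl⟩
    have := h _ (Function.invFunOn_mem hex) y hy
    rw [Function.invFunOn_eq hex, dist_self, mul_zero] at this
    exact dist_le_zero.1 this
  have himg : φ '' s = (fun w => φ (Function.invFunOn ψ s w)) '' (ψ '' s) := by
    rw [Set.image_image]
    exact Set.image_congr fun y hy => (hinv y hy).symm
  have hlip : LipschitzOnWith C (fun w => φ (Function.invFunOn ψ s w)) (ψ '' s) := by
    refine LipschitzOnWith.of_dist_le_mul ?_
    rintro _ ⟨y, hy, rfl⟩ _ ⟨z, hz, rfl⟩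
    rw [hinv y hy, hinv z hz]
    exact h y hy z hz
  rw [himg]
  simpa using hlip.hausdorffMeasure_image_le (d := 2) (by norm_num)

namespace GraphChart

variable {S : Surface3} (c : GraphChart S)

lemma exists_locally_comparable {q : E2} (hq : q ∈ c.V) {C : NNReal} (hC : 1 < C) :
    ∃ O ∈ nhds q, ∀ s ⊆ O ∩ c.V, MeasurableSet s →
      μH[2] (c.g '' s) ≤ (C : ENNReal) ^ 3 * ∫⁻ y in s, ENNReal.ofReal (c.jac y) ∂μH[2] ∧
      ∫⁻ y in s, ENNReal.ofReal (c.jac y) ∂μH[2] ≤ (C : ENNReal) ^ 3 * μH[2] (c.g '' s) := by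
  have hC1 : (1 : ℝ) < C := by exact_mod_cast hC
  have hC0 : (0 : ℝ) < C := by linarith
  obtain ⟨B, hdet, -, hB⟩ := c.exists_linear_approx hq
  set δ : ℝ := 1 - (C : ℝ)⁻¹ with hδdef
  have hinv1 : (C : ℝ)⁻¹ < 1 := inv_lt_one_of_one_lt₀ hC1
  have hδ : 0 < δ := by linarith
  have hCC : (C : ℝ) * (C : ℝ)⁻¹ = 1 := mul_inv_cancel₀ hC0.ne'
  have hδC : 1 + δ ≤ C := by
    have : 0 ≤ ((C : ℝ) - 1) ^ 2 * (C : ℝ)⁻¹ := by positivity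
    have h2 : ((C : ℝ) - 1) ^ 2 * (C : ℝ)⁻¹ = C - 2 + (C : ℝ)⁻¹ := by
      linear_combination ((C : ℝ) - 2) * hCC
    linarith
  obtain ⟨O, hO, hOB⟩ := hB δ hδ
  have hjq := c.jac_pos hq
  have hcont := c.continuousOn_jac.continuousAt (c.isOpen_V.mem_nhds hq)
  have h1 : ∀ᶠ y in nhds q, c.jac q < C * c.jac y :=
    (hcont.const_mul (C : ℝ)).eventually_const_lt (by nlinarith)
  have h2 : ∀ᶠ y in nhds q, c.jac y < C * c.jac q :=
    hcont.eventually_lt_const (by nlinarith)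
  refine ⟨O ∩ {y | c.jac q < C * c.jac y ∧ c.jac y < C * c.jac q},
    Filter.inter_mem hO (h1.and h2), fun s hs hsm => ?_⟩
  have hBs : μH[2] (B '' s) = ENNReal.ofReal (c.jac q) * μH[2] s := by
    rw [Measure.addHaar_image_linearMap, hdet]
  have e1 : μH[2] (c.g '' s) ≤ (C : ENNReal) ^ 2 * μH[2] (B '' s) := by
    refine hausdorffMeasure_image_le_image fun y hy z hz => ?_
    have := (abs_le.1 (hOB y (hs hy).1.1 z (hs hz).1.1)).2
    rw [dist_eq_norm, dist_eq_norm]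
    nlinarith [norm_nonneg (B y - B z)]
  have e2 : μH[2] (B '' s) ≤ (C : ENNReal) ^ 2 * μH[2] (c.g '' s) := by
    refine hausdorffMeasure_image_le_image fun y hy z hz => ?_
    have := (abs_le.1 (hOB y (hs hy).1.1 z (hs hz).1.1)).1
    rw [dist_eq_norm, dist_eq_norm]
    have h3 : (C : ℝ)⁻¹ * ‖B y - B z‖ ≤ ‖c.g y - c.g z‖ := by rw [hδdef] at this; linarith
    calc ‖B y - B z‖ = C * ((C : ℝ)⁻¹ * ‖B y - B z‖) := by rw [← mul_assoc, hCC, one_mul]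
      _ ≤ _ := by gcongr
  have hconst : ∫⁻ _ in s, ENNReal.ofReal (c.jac q) ∂μH[2] = μH[2] (B '' s) := by
    rw [hBs, setLIntegral_const]
  have hCofReal : (C : ENNReal) = ENNReal.ofReal C := by simp
  have f1 : μH[2] (B '' s) ≤ C * ∫⁻ y in s, ENNReal.ofReal (c.jac y) ∂μH[2] := by
    rw [← hconst, ← lintegral_const_mul' _ _ ENNReal.coe_ne_top]
    refine setLIntegral_mono' hsm fun y hy => ?_
    rw [hCofReal, ← ENNReal.ofReal_mul hC0.le]
    exact ENNReal.ofReal_le_ofReal (hs hy).1.2.1.le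
  have f2 : ∫⁻ y in s, ENNReal.ofReal (c.jac y) ∂μH[2] ≤ C * μH[2] (B '' s) := by
    rw [← hconst, ← lintegral_const_mul' _ _ ENNReal.coe_ne_top]
    refine setLIntegral_mono' hsm fun y hy => ?_
    rw [hCofReal, ← ENNReal.ofReal_mul hC0.le]
    exact ENNReal.ofReal_le_ofReal (hs hy).1.2.2.le
  constructor
  · calc _ ≤ _ := e1
      _ ≤ (C : ENNReal) ^ 2 * (C * ∫⁻ y in s, ENNReal.ofReal (c.jac y) ∂μH[2]) := by gcongr
      _ = _ := by ring
  · calc _ ≤ _ := f2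
      _ ≤ C * ((C : ENNReal) ^ 2 * μH[2] (c.g '' s)) := by gcongr
      _ = _ := by ring

lemma _root_.ENNReal.le_of_forall_one_lt_pow_mul_le {a b : ENNReal}
    (h : ∀ C : NNReal, 1 < C → a ≤ (C : ENNReal) ^ 3 * b) : a ≤ b := by
  have hlim : Filter.Tendsto (fun C : NNReal => (C : ENNReal) ^ 3 * b) (nhdsWithin 1 (Set.Ioi 1))
      (nhds (((1 : NNReal) : ENNReal) ^ 3 * b)) := by
    refine ENNReal.Tendsto.mul_const ?_ (Or.inl (by simp))
    refine tendsto_nhdsWithin_of_tendsto_nhds ?_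
    exact (ENNReal.continuous_pow 3).continuousAt.comp ENNReal.continuous_coe.continuousAt
  refine (ge_of_tendsto hlim ?_).trans (by simp)
  filter_upwards [self_mem_nhdsWithin] with C hC using h C hC

/-- **Area formula** in a graph chart. -/
lemma map_hausdorffMeasure (hclosed : IsClosed S.carrier) :
    (μH[2].restrict (S.carrier ∩ c.U)).map (graphProj c.b) =
      (μH[2].restrict c.V).withDensity fun y => ENNReal.ofReal (c.jac y) := by
  have hM : MeasurableSet (S.carrier ∩ c.U) := hclosed.measurableSet.inter c.isOpen_U.measurableSet
  have hV := c.isOpen_V.measurableSet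
  set m := (μH[2].restrict (S.carrier ∩ c.U)).map (graphProj c.b) with hm
  set n := (μH[2].restrict c.V).withDensity fun y => ENNReal.ofReal (c.jac y) with hn
  have hπ : Measurable (graphProj c.b) := (graphProj c.b).continuous.measurable
  have hms : ∀ s, MeasurableSet s → m s = μH[2] (graphProj c.b ⁻¹' s ∩ (S.carrier ∩ c.U)) :=
    fun s hs => by rw [hm, Measure.map_apply hπ hs, Measure.restrict_apply (hπ hs)]
  have hmV : m c.Vᶜ = 0 := by
    rw [hms _ hV.compl, show graphProj c.b ⁻¹' c.Vᶜ ∩ (S.carrier ∩ c.U) = ∅ from ?_, measure_empty]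
    exact Set.eq_empty_of_forall_notMem fun x hx => hx.1 (c.proj_mem x hx.2)
  have hnV : n c.Vᶜ = 0 := by
    rw [hn, withDensity_apply _ hV.compl, Measure.restrict_restrict hV.compl]
    simp
  have hms' : ∀ s ⊆ c.V, MeasurableSet s → m s = μH[2] (c.g '' s) := fun s hsV hs => by
    rw [hms s hs, c.image_eq hsV]
  have hns : ∀ s ⊆ c.V, MeasurableSet s → n s = ∫⁻ y in s, ENNReal.ofReal (c.jac y) ∂μH[2] :=
    fun s hsV hs => by
      rw [hn, withDensity_apply _ hs, Measure.restrict_restrict hs, Set.inter_eq_left.2 hsV]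
  refine le_antisymm (Measure.le_iff.2 fun s _ => ?_) (Measure.le_iff.2 fun s _ => ?_)
  all_goals refine ENNReal.le_of_forall_one_lt_pow_mul_le fun C hC => ?_
  · have : m ≤ ((C : ENNReal) ^ 3) • n := by
      refine measure_le_of_locally_le hV hmV fun q hq => ?_
      obtain ⟨O, hO, h⟩ := c.exists_locally_comparable hq hC
      refine ⟨O, hO, fun s hs hsm => ?_⟩
      have hsV : s ⊆ c.V := fun y hy => (hs hy).2
      rw [Measure.smul_apply, smul_eq_mul, hms' s hsV hsm, hns s hsV hsm]
      exact (h s hs hsm).1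
    simpa using this s
  · have : n ≤ ((C : ENNReal) ^ 3) • m := by
      refine measure_le_of_locally_le hV hnV fun q hq => ?_
      obtain ⟨O, hO, h⟩ := c.exists_locally_comparable hq hC
      refine ⟨O, hO, fun s hs hsm => ?_⟩
      have hsV : s ⊆ c.V := fun y hy => (hs hy).2
      rw [Measure.smul_apply, smul_eq_mul, hms' s hsV hsm, hns s hsV hsm]
      exact (h s hs hsm).2
    simpa using this s

end GraphChart

/-- The pointwise algebra behind the divergence theorem in a graph chart: `n` is a unit normal,
`M i j` is the `j`-th component of its derivative along the `i`-th coordinate tangent vector. -/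
lemma graph_divergence_identity {x₀ x₁ x₂ n₀ n₁ n₂ z₀ z₁ z₂ ζ h T₀ T₁ T₂ ρ
    M₀₀ M₀₁ M₀₂ M₁₀ M₁₁ M₁₂ : ℝ} (hρ : ρ * n₂ = 1)
    (hunit : n₀ * n₀ + n₁ * n₁ + n₂ * n₂ = 1)
    (t₀ : n₀ * M₀₀ + n₁ * M₀₁ + n₂ * M₀₂ = 0)
    (t₁ : n₀ * M₁₀ + n₁ * M₁₁ + n₂ * M₁₂ = 0)
    (hsymm : M₀₁ - n₁ * ρ * M₀₂ = M₁₀ - n₀ * ρ * M₁₂)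
    (hh : h = x₀ * n₀ + x₁ * n₁ + x₂ * n₂)
    (hT₀ : T₀ = x₀ - h * n₀) (hT₁ : T₁ = x₁ - h * n₁) (hT₂ : T₂ = x₂ - h * n₂)
    (hH : M₀₀ + M₁₁ = 1 / 2 * h) :
    ((z₀ - n₀ * ρ * z₂) * (T₀ * ρ) + ζ * ((1 - (x₀ * M₀₀ + x₁ * M₀₁ + x₂ * M₀₂) * n₀ - h * M₀₀) * ρ
        - T₀ * M₀₂ * ρ ^ 2))
      + ((z₁ - n₁ * ρ * z₂) * (T₁ * ρ) + ζ * ((1 - (x₀ * M₁₀ + x₁ * M₁₁ + x₂ * M₁₂) * n₁ - h * M₁₁) * ρ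
        - T₁ * M₁₂ * ρ ^ 2)) =
    ρ * (z₀ * T₀ + z₁ * T₁ + z₂ * T₂ + ζ * (2 - 1 / 2 * h ^ 2)) := by
  have hnT : n₀ * T₀ + n₁ * T₁ + n₂ * T₂ = 0 := by
    rw [hT₀, hT₁, hT₂]
    linear_combination -h * hunit - hh
  have hT : T₂ = -ρ * (n₀ * T₀ + n₁ * T₁) := by
    linear_combination ρ * hnT - T₂ * hρ
  have c₀ : n₀ * (M₀₀ - n₀ * ρ * M₀₂) + n₁ * (M₁₀ - n₀ * ρ * M₁₂) + ρ * M₀₂ = 0 := by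
    linear_combination t₀ - n₁ * hsymm - ρ * M₀₂ * hunit + n₂ * M₀₂ * hρ
  have c₁ : n₀ * (M₀₁ - n₁ * ρ * M₀₂) + n₁ * (M₁₁ - n₁ * ρ * M₁₂) + ρ * M₁₂ = 0 := by
    linear_combination t₁ + n₀ * hsymm - ρ * M₁₂ * hunit + n₂ * M₁₂ * hρ
  have hx₀ : x₀ * M₀₀ + x₁ * M₀₁ + x₂ * M₀₂ = T₀ * M₀₀ + T₁ * M₀₁ + T₂ * M₀₂ := by
    rw [hT₀, hT₁, hT₂]
    linear_combination h * t₀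
  have hx₁ : x₀ * M₁₀ + x₁ * M₁₁ + x₂ * M₁₂ = T₀ * M₁₀ + T₁ * M₁₁ + T₂ * M₁₂ := by
    rw [hT₀, hT₁, hT₂]
    linear_combination h * t₁
  rw [hx₀, hx₁, hT]
  linear_combination -ζ * ρ * T₀ * c₀ - ζ * ρ * T₁ * c₁ - ζ * ρ * h * hH

/-- The divergence of the tangential part of `ζ x` along a self-shrinker. -/
def shrinkerDiv (S : Surface3) (ζ : E3 → ℝ) (x : E3) : ℝ :=
  fderiv ℝ ζ x (x - ⟪x, S.ν x⟫ • S.ν x) + ζ x * (2 - 1 / 2 * ⟪x, S.ν x⟫ ^ 2)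

lemma shrinkerDiv_eq_zero {S : Surface3} {ζ : E3 → ℝ} {x : E3} (hx : x ∉ tsupport ζ) :
    shrinkerDiv S ζ x = 0 := by
  have h1 : fderiv ℝ ζ x = 0 := by
    by_contra hne
    exact hx (tsupport_fderiv_subset ℝ (subset_tsupport _ hne))
  simp [shrinkerDiv, h1, image_eq_zero_of_notMem_tsupport hx]

namespace GraphChart

variable {S : Surface3} (c : GraphChart S)

lemma zero_extension (hclosed : IsClosed S.carrier) {T : Set E3} (hT : IsCompact T)
    (hTU : T ⊆ c.U) {h : E2 → ℝ} (hh : ContinuousOn h c.V)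
    (h0 : ∀ y ∈ c.V, c.g y ∉ T → h y = 0) :
    Continuous (c.V.indicator h) ∧ HasCompactSupport (c.V.indicator h) ∧
      ∀ y ∉ c.V, c.V.indicator h =ᶠ[nhds y] 0 := by
  set Z := graphProj c.b '' (S.carrier ∩ T) with hZ
  have hZc : IsCompact Z := (hT.inter_left hclosed).image (graphProj c.b).continuous
  have hZV : Z ⊆ c.V := by
    rintro _ ⟨x, hx, rfl⟩
    exact c.proj_mem x ⟨hx.1, hTU hx.2⟩
  have hzero : ∀ y ∉ Z, c.V.indicator h y = 0 := fun y hy => by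
    by_cases hyV : y ∈ c.V
    · rw [Set.indicator_of_mem hyV]
      refine h0 y hyV fun hgT => hy ⟨c.g y, ⟨(c.g_mem y hyV).1, hgT⟩, c.proj_g y hyV⟩
    · exact Set.indicator_of_notMem hyV _
  have hev : ∀ y ∉ c.V, c.V.indicator h =ᶠ[nhds y] 0 := fun y hy => by
    filter_upwards [hZc.isClosed.isOpen_compl.mem_nhds fun hyZ => hy (hZV hyZ)] with w hw
      using hzero w hw
  refine ⟨continuous_iff_continuousAt.2 fun y => ?_, HasCompactSupport.intro hZc hzero, hev⟩
  by_cases hyV : y ∈ c.V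
  · have hnhds := c.isOpen_V.mem_nhds hyV
    refine (hh.continuousAt hnhds).congr ?_
    filter_upwards [hnhds] with w hw using (Set.indicator_of_mem hw h).symm
  · exact continuousAt_const.congr (hev y hyV).symm

lemma continuousOn_graphDeriv (e : E2) :
    ContinuousOn (fun y => graphDeriv c.b (S.ν (c.g y)) e) c.V := by
  have hν := c.continuousOn_normal_g
  simp only [graphDeriv_apply]
  refine continuousOn_const.sub (ContinuousOn.fun_smul ?_ continuousOn_const)
  refine ContinuousOn.div ?_ (hν.inner continuousOn_const)
    fun y hy => (c.normal_pos _ (c.g_mem y hy).2).ne'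
  exact ((hν.inner continuousOn_const).mul continuousOn_const).add
    ((hν.inner continuousOn_const).mul continuousOn_const)

/-- The integral over the parameter domain of a coordinate derivative vanishes. -/
lemma integral_deriv_eq_zero (hclosed : IsClosed S.carrier) {k : E3 → ℝ} (hk : ContDiff ℝ 1 k)
    (hkc : HasCompactSupport k) (hkU : tsupport k ⊆ c.U) (e : E2) :
    Integrable (c.V.indicator fun y => fderiv ℝ k (c.g y) (graphDeriv c.b (S.ν (c.g y)) e))
      (μH[2] : Measure E2) ∧
    ∫ y, c.V.indicator (fun y => fderiv ℝ k (c.g y) (graphDeriv c.b (S.ν (c.g y)) e)) y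
      ∂(μH[2] : Measure E2) = 0 := by
  set h' := fun y => fderiv ℝ k (c.g y) (graphDeriv c.b (S.ν (c.g y)) e) with hh'
  have hcont' : ContinuousOn h' c.V :=
    (((hk.continuous_fderiv one_ne_zero).comp_continuousOn c.continuousOn_g)).clm_apply
      (c.continuousOn_graphDeriv e)
  obtain ⟨hw'c, hw's, -⟩ := c.zero_extension hclosed hkc hkU hcont' fun y _ hgy => by
    have : fderiv ℝ k (c.g y) = 0 := by
      by_contra hne
      exact hgy (tsupport_fderiv_subset ℝ (subset_tsupport _ hne))
    simp [hh', this]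
  obtain ⟨hwc, hws, hw0⟩ := c.zero_extension hclosed hkc hkU
    (h := fun y => k (c.g y)) (hk.continuous.comp_continuousOn c.continuousOn_g)
    fun y _ hgy => image_eq_zero_of_notMem_tsupport (f := k) hgy
  have hint' := hw'c.integrable_of_hasCompactSupport hw's (μ := μH[2])
  have hint := hwc.integrable_of_hasCompactSupport hws (μ := μH[2])
  refine ⟨hint', ?_⟩
  have hderiv : ∀ y, HasLineDerivAt ℝ (c.V.indicator fun y => k (c.g y)) (c.V.indicator h' y) y e := by
    intro y
    by_cases hyV : y ∈ c.V
    · have h1 : HasFDerivAt (fun y => k (c.g y))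
          ((fderiv ℝ k (c.g y)).comp (graphDeriv c.b (S.ν (c.g y)))) y :=
        ((hk.differentiable one_ne_zero _).hasFDerivAt).comp y
          (c.hasStrictFDerivAt y hyV).hasFDerivAt
      have h2 := h1.congr_of_eventuallyEq (f₁ := c.V.indicator fun y => k (c.g y)) (by
        filter_upwards [c.isOpen_V.mem_nhds hyV] with w hw using Set.indicator_of_mem hw _)
      rw [Set.indicator_of_mem hyV]
      exact h2.hasLineDerivAt e
    · have h2 : HasFDerivAt (c.V.indicator fun y => k (c.g y)) (0 : E2 →L[ℝ] ℝ) y :=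
        (hasFDerivAt_const (0 : ℝ) y).congr_of_eventuallyEq (hw0 y hyV)
      rw [Set.indicator_of_notMem hyV]
      simpa using h2.hasLineDerivAt e
  have := integral_bilinear_hasLineDerivAt_right_eq_neg_left_of_integrable
    (μ := (μH[2] : Measure E2)) (f := fun _ => (1 : ℝ)) (f' := fun _ => 0)
    (g := c.V.indicator fun y => k (c.g y)) (g' := c.V.indicator h') (v := e)
    (B := ContinuousLinearMap.mul ℝ ℝ) (by simp) (by simpa using hint') (by simpa using hint)
    (fun x _ => by simpa using (hasFDerivAt_const (1 : ℝ) x).hasLineDerivAt e)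
    (fun x _ => hderiv x)
  simpa using this

end GraphChart

lemma meanCurv_eq_sum_three (S : Surface3) (b : OrthonormalBasis (Fin 3) ℝ E3) (x : E3) :
    meanCurv S x = ⟪fderiv ℝ S.ν x (b 0), b 0⟫ + ⟪fderiv ℝ S.ν x (b 1), b 1⟫
      + ⟪fderiv ℝ S.ν x (b 2), b 2⟫ := by
  have h1 := LinearMap.trace_eq_sum_inner (fderiv ℝ S.ν x : E3 →ₗ[ℝ] E3) b
  have h2 := LinearMap.trace_eq_sum_inner (fderiv ℝ S.ν x : E3 →ₗ[ℝ] E3)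
    (EuclideanSpace.basisFun (Fin 3) ℝ)
  rw [h1, Fin.sum_univ_three] at h2
  simp only [ContinuousLinearMap.coe_coe, EuclideanSpace.basisFun_apply] at h2
  simp only [meanCurv, fun v => real_inner_comm v (fderiv ℝ S.ν x v)] at h2 ⊢
  exact h2.symm

namespace GraphChart

variable {S : Surface3} (c : GraphChart S)

/-- The coordinates in the parameter plane of the tangential part of `ζ x`, scaled by the area
density. -/
def fluxCoord (ζ : E3 → ℝ) (i : Fin 3) (x : E3) : ℝ :=
  ζ x * ((⟪x, c.b i⟫ - ⟪x, S.ν x⟫ * ⟪S.ν x, c.b i⟫) / ⟪S.ν x, c.b 2⟫)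

lemma tsupport_fluxCoord_subset (ζ : E3 → ℝ) (i : Fin 3) :
    tsupport (c.fluxCoord ζ i) ⊆ tsupport ζ := tsupport_mul_subset_left

lemma contDiffAt_normal {x : E3} (hx : x ∈ c.U) : ContDiffAt ℝ (⊤ : ℕ∞) S.ν x :=
  c.normal_smooth.contDiffAt (c.isOpen_U.mem_nhds hx)

lemma contDiff_fluxCoord {ζ : E3 → ℝ} (hζ : ContDiff ℝ 1 ζ) (hζU : tsupport ζ ⊆ c.U) (i : Fin 3) :
    ContDiff ℝ 1 (c.fluxCoord ζ i) := by
  refine contDiff_iff_contDiffAt.2 fun x => ?_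
  by_cases hx : x ∈ c.U
  · have hν : ContDiffAt ℝ 1 S.ν x := (c.contDiffAt_normal hx).of_le (by exact_mod_cast le_top)
    exact hζ.contDiffAt.mul (((contDiffAt_id.inner ℝ contDiffAt_const).sub
      ((contDiffAt_id.inner ℝ hν).mul (hν.inner ℝ contDiffAt_const))).div
        (hν.inner ℝ contDiffAt_const) (c.normal_pos x hx).ne')
  · have hx' : x ∉ tsupport (c.fluxCoord ζ i) := fun h =>
      hx (hζU (c.tsupport_fluxCoord_subset ζ i h))
    exact contDiffAt_const.congr_of_eventuallyEq (notMem_tsupport_iff_eventuallyEq.1 hx')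

lemma fderiv_fluxCoord {ζ : E3 → ℝ} (hζ : ContDiff ℝ 1 ζ) (hζU : tsupport ζ ⊆ c.U) (i : Fin 3)
    {x : E3} (hx : x ∈ c.U) (v : E3) :
    fderiv ℝ (c.fluxCoord ζ i) x v =
      fderiv ℝ ζ x v * ((⟪x, c.b i⟫ - ⟪x, S.ν x⟫ * ⟪S.ν x, c.b i⟫) / ⟪S.ν x, c.b 2⟫) +
      ζ x * (((⟪v, c.b i⟫ - ((⟪x, fderiv ℝ S.ν x v⟫ + ⟪v, S.ν x⟫) * ⟪S.ν x, c.b i⟫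
          + ⟪x, S.ν x⟫ * ⟪fderiv ℝ S.ν x v, c.b i⟫)) * ⟪S.ν x, c.b 2⟫
        - (⟪x, c.b i⟫ - ⟪x, S.ν x⟫ * ⟪S.ν x, c.b i⟫) * ⟪fderiv ℝ S.ν x v, c.b 2⟫)
          / ⟪S.ν x, c.b 2⟫ ^ 2) := by
  have hγ : HasDerivAt (fun t : ℝ => x + t • v) v 0 := by
    simpa using ((hasDerivAt_id (0 : ℝ)).smul_const v).const_add x
  have hx0 : x + (0 : ℝ) • v = x := by simp
  have comp {F : Type} [NormedAddCommGroup F] [NormedSpace ℝ F] {f : E3 → F}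
      (hf : DifferentiableAt ℝ f x) :
      HasDerivAt (fun t : ℝ => f (x + t • v)) (fderiv ℝ f x v) 0 :=
    HasFDerivAt.comp_hasDerivAt_of_eq (0 : ℝ) hf.hasFDerivAt hγ hx0.symm
  have hν := comp ((c.contDiffAt_normal hx).differentiableAt (by simp))
  have hz := comp (hζ.differentiable one_ne_zero x)
  have hk := comp ((c.contDiff_fluxCoord hζ hζU i).differentiable one_ne_zero x)
  have hc (w : E3) := hasDerivAt_const (0 : ℝ) w
  have key := hz.mul ((((hγ.inner ℝ (hc (c.b i))).sub
    ((hγ.inner ℝ hν).mul (hν.inner ℝ (hc (c.b i)))))).div (hν.inner ℝ (hc (c.b 2)))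
      (by rw [hx0]; exact (c.normal_pos x hx).ne'))
  have := hk.unique key
  rw [this]
  simp

/-- In the chart, the weighted divergence is a sum of coordinate derivatives. -/
lemma sum_fderiv_fluxCoord (hS : IsShrinker S) {ζ : E3 → ℝ} (hζ : ContDiff ℝ 1 ζ)
    (hζU : tsupport ζ ⊆ c.U) {y : E2} (hy : y ∈ c.V) :
    fderiv ℝ (c.fluxCoord ζ 0) (c.g y) (graphDeriv c.b (S.ν (c.g y)) (EuclideanSpace.single 0 1))
      + fderiv ℝ (c.fluxCoord ζ 1) (c.g y)
        (graphDeriv c.b (S.ν (c.g y)) (EuclideanSpace.single 1 1))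
      = c.jac y * shrinkerDiv S ζ (c.g y) := by
  obtain ⟨hxM, hxU⟩ := c.g_mem y hy
  rw [jac]
  set x := c.g y
  set n := S.ν x with hn
  set D := fderiv ℝ S.ν x with hD
  have hn2 : ⟪n, c.b 2⟫ ≠ 0 := (c.normal_pos x hxU).ne'
  have hperp (v : E3) : ⟪n, D v⟫ = 0 := by
    have hd := ((c.contDiffAt_normal hxU).differentiableAt (by simp)).hasFDerivAt
    have h1 := hd.inner ℝ hd
    have h2 : HasFDerivAt (fun t => ⟪S.ν t, S.ν t⟫) (0 : E3 →L[ℝ] ℝ) x := by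
      refine (hasFDerivAt_const (1 : ℝ) x).congr_of_eventuallyEq ?_
      filter_upwards [c.isOpen_U.mem_nhds hxU] with w hw
      rw [real_inner_self_eq_norm_sq, c.normal_norm w hw, one_pow]
    have h3 := congrArg (fun L : E3 →L[ℝ] ℝ => L v) (h1.unique h2)
    simp only [ContinuousLinearMap.comp_apply, ContinuousLinearMap.prod_apply,
      fderivInnerCLM_apply, zero_apply] at h3
    rw [← hD, ← hn, real_inner_comm n (D v)] at h3
    linarith
  have hv0 : graphDeriv c.b n (EuclideanSpace.single 0 1)
      = c.b 0 - (⟪n, c.b 0⟫ * ⟪n, c.b 2⟫⁻¹) • c.b 2 := by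
    simp [graphDeriv_apply, div_eq_mul_inv]
  have hv1 : graphDeriv c.b n (EuclideanSpace.single 1 1)
      = c.b 1 - (⟪n, c.b 1⟫ * ⟪n, c.b 2⟫⁻¹) • c.b 2 := by
    simp [graphDeriv_apply, div_eq_mul_inv]
  have hnv0 := inner_graphDeriv c.b hn2 (EuclideanSpace.single 0 1)
  have hnv1 := inner_graphDeriv c.b hn2 (EuclideanSpace.single 1 1)
  set v₀ := graphDeriv c.b n (EuclideanSpace.single 0 1)
  set v₁ := graphDeriv c.b n (EuclideanSpace.single 1 1)
  have hsymm : ⟪D v₀, v₁⟫ = ⟪D v₁, v₀⟫ := by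
    obtain ⟨α, hα⟩ := c.normal_symm x hxU
    have := hα v₀ v₁
    rw [← hn, hnv0, hnv1] at this
    linarith
  have hunit : ⟪n, n⟫ = 1 := by
    rw [real_inner_self_eq_norm_sq, c.normal_norm x hxU, one_pow]
  have hH := hS x hxM
  rw [meanCurv_eq_sum_three S c.b] at hH
  have hperp' (v : E3) := (inner_eq_sum_three c.b n (D v)).symm.trans (hperp v)
  have hρ : ⟪n, c.b 2⟫⁻¹ * ⟪n, c.b 2⟫ = 1 := inv_mul_cancel₀ hn2
  have key := graph_divergence_identity (z₀ := fderiv ℝ ζ x (c.b 0)) (z₁ := fderiv ℝ ζ x (c.b 1))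
    (z₂ := fderiv ℝ ζ x (c.b 2)) (ζ := ζ x) hρ
    ((inner_eq_sum_three c.b n n).symm.trans hunit) (hperp' v₀) (hperp' v₁)
    (by
      rw [hv0, hv1] at hsymm
      simp only [inner_sub_right, inner_smul_right] at hsymm
      rw [hv0, hv1]
      linear_combination hsymm)
    (inner_eq_sum_three c.b x n) rfl rfl rfl
    (by
      have h2 := hperp' (c.b 2)
      rw [hv0, hv1]
      simp only [map_sub, map_smul, inner_sub_left, inner_smul_left, conj_trivial]
      linear_combination hH - ⟪n, c.b 2⟫⁻¹ * h2 + ⟪D (c.b 2), c.b 2⟫ * hρ)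
  have hxn : x - ⟪x, n⟫ • n = (⟪x, c.b 0⟫ - ⟪x, n⟫ * ⟪n, c.b 0⟫) • c.b 0
      + (⟪x, c.b 1⟫ - ⟪x, n⟫ * ⟪n, c.b 1⟫) • c.b 1
      + (⟪x, c.b 2⟫ - ⟪x, n⟫ * ⟪n, c.b 2⟫) • c.b 2 := by
    conv_lhs => rw [← c.b.sum_repr' (x - ⟪x, n⟫ • n), Fin.sum_univ_three]
    simp only [inner_sub_right, inner_smul_right, real_inner_comm]
  rw [c.fderiv_fluxCoord hζ hζU 0 hxU, c.fderiv_fluxCoord hζ hζU 1 hxU, shrinkerDiv, ← hD, ← hn,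
    hxn, inner_eq_sum_three c.b x (D v₀), inner_eq_sum_three c.b x (D v₁),
    real_inner_comm n v₀, real_inner_comm n v₁, hnv0, hnv1]
  have hz₀ : fderiv ℝ ζ x v₀ = fderiv ℝ ζ x (c.b 0)
      - ⟪n, c.b 0⟫ * ⟪n, c.b 2⟫⁻¹ * fderiv ℝ ζ x (c.b 2) := by
    rw [hv0, map_sub, map_smul, smul_eq_mul]
  have hz₁ : fderiv ℝ ζ x v₁ = fderiv ℝ ζ x (c.b 1)
      - ⟪n, c.b 1⟫ * ⟪n, c.b 2⟫⁻¹ * fderiv ℝ ζ x (c.b 2) := by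
    rw [hv1, map_sub, map_smul, smul_eq_mul]
  have hv₀ : ⟪v₀, c.b 0⟫ = 1 := by simp [hv0, inner_sub_left, inner_smul_left]
  have hv₁ : ⟪v₁, c.b 1⟫ = 1 := by simp [hv1, inner_sub_left, inner_smul_left]
  rw [hz₀, hz₁, hv₀, hv₁]
  simp only [map_add, map_smul, smul_eq_mul, one_div] at key ⊢
  convert key using 1
  · field_simp
    ring
  · ring

/-- The divergence theorem for a test function supported in a graph chart. -/
lemma integral_shrinkerDiv (hS : IsShrinker S) (hclosed : IsClosed S.carrier) {ζ : E3 → ℝ}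
    (hζ : ContDiff ℝ 1 ζ) (hζc : HasCompactSupport ζ) (hζU : tsupport ζ ⊆ c.U) :
    IntegrableOn (shrinkerDiv S ζ) S.carrier μH[2] ∧
      ∫ x in S.carrier, shrinkerDiv S ζ x ∂μH[2] = 0 := by
  have hUm : MeasurableSet (S.carrier ∩ c.U) := hclosed.measurableSet.inter c.isOpen_U.measurableSet
  have hVm := c.isOpen_V.measurableSet
  have hzero : ∀ x ∈ S.carrier \ (S.carrier ∩ c.U), shrinkerDiv S ζ x = 0 := fun x hx =>
    shrinkerDiv_eq_zero fun hxs => hx.2 ⟨hx.1, hζU hxs⟩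
  have hsub (i : Fin 3) := c.tsupport_fluxCoord_subset ζ i
  have h0 := c.integral_deriv_eq_zero hclosed (c.contDiff_fluxCoord hζ hζU 0)
    (hζc.of_isClosed_subset (isClosed_tsupport _) (hsub 0)) ((hsub 0).trans hζU)
    (EuclideanSpace.single 0 1)
  have h1 := c.integral_deriv_eq_zero hclosed (c.contDiff_fluxCoord hζ hζU 1)
    (hζc.of_isClosed_subset (isClosed_tsupport _) (hsub 1)) ((hsub 1).trans hζU)
    (EuclideanSpace.single 1 1)
  set F : E2 → ℝ := fun y => shrinkerDiv S ζ (c.g y) with hF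
  have hsum : c.V.indicator (fun y => c.jac y * F y) = fun y =>
      c.V.indicator (fun y => fderiv ℝ (c.fluxCoord ζ 0) (c.g y)
        (graphDeriv c.b (S.ν (c.g y)) (EuclideanSpace.single 0 1))) y
      + c.V.indicator (fun y => fderiv ℝ (c.fluxCoord ζ 1) (c.g y)
        (graphDeriv c.b (S.ν (c.g y)) (EuclideanSpace.single 1 1))) y := by
    funext y
    by_cases hy : y ∈ c.V
    · simp only [Set.indicator_of_mem hy]
      exact (c.sum_fderiv_fluxCoord hS hζ hζU hy).symm
    · simp only [Set.indicator_of_notMem hy, add_zero]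
  have hJint : IntegrableOn (fun y => c.jac y * F y) c.V (μH[2] : Measure E2) := by
    rw [← integrable_indicator_iff hVm, hsum]
    exact h0.1.add h1.1
  have hJzero : ∫ y in c.V, c.jac y * F y ∂(μH[2] : Measure E2) = 0 := by
    rw [← integral_indicator hVm, hsum, integral_add h0.1 h1.1, h0.2, h1.2, add_zero]
  have hjac : AEMeasurable (fun y => ENNReal.ofReal (c.jac y)) ((μH[2] : Measure E2).restrict c.V) :=
    (c.continuousOn_jac.aemeasurable hVm).ennreal_ofReal
  have hfin : ∀ᵐ y ∂(μH[2] : Measure E2).restrict c.V, ENNReal.ofReal (c.jac y) < ⊤ :=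
    ae_of_all _ fun _ => ENNReal.ofReal_lt_top
  have hae : (fun y => (ENNReal.ofReal (c.jac y)).toReal • F y)
      =ᵐ[(μH[2] : Measure E2).restrict c.V] fun y => c.jac y * F y := by
    filter_upwards [ae_restrict_mem hVm] with y hy
    rw [ENNReal.toReal_ofReal (c.jac_pos hy).le, smul_eq_mul]
  have hFint : Integrable F ((μH[2].restrict (S.carrier ∩ c.U)).map (graphProj c.b)) := by
    rw [c.map_hausdorffMeasure hclosed, integrable_withDensity_iff_integrable_smul₀' hjac hfin,
      integrable_congr hae]
    exact hJint
  have hFzero : ∫ y, F y ∂(μH[2].restrict (S.carrier ∩ c.U)).map (graphProj c.b) = 0 := by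
    rw [c.map_hausdorffMeasure hclosed, integral_withDensity_eq_integral_toReal_smul₀ hjac hfin,
      integral_congr_ae hae]
    exact hJzero
  have hproj : AEMeasurable (graphProj c.b) (μH[2].restrict (S.carrier ∩ c.U)) :=
    (graphProj c.b).continuous.measurable.aemeasurable
  have hcongr : Set.EqOn (F ∘ graphProj c.b) (shrinkerDiv S ζ) (S.carrier ∩ c.U) := fun x hx => by
    simp only [hF, Function.comp_apply, c.g_proj x hx]
  constructor
  · refine IntegrableOn.of_forall_sdiff_eq_zero ?_ hclosed.measurableSet hzero
    exact (integrableOn_congr_fun hcongr hUm).1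
      ((integrable_map_measure hFint.aestronglyMeasurable hproj).1 hFint)
  · rw [setIntegral_eq_of_subset_of_forall_sdiff_eq_zero hclosed.measurableSet
      Set.inter_subset_left hzero, ← setIntegral_congr_fun hUm hcongr]
    rw [integral_map hproj hFint.aestronglyMeasurable] at hFzero
    exact hFzero

end GraphChart

/-- Near a point of the surface, the normal field is a smooth unit field proportional to the
differential of a defining function, and has the symmetries of a normalized gradient. -/
lemma Surface3.exists_smooth_normal (S : Surface3) {p : E3} (hp : p ∈ S.carrier) :
    ∃ U : Set E3, IsOpen U ∧ p ∈ U ∧ ∃ f : E3 → ℝ, ContDiffOn ℝ (⊤ : ℕ∞) f U ∧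
      (∀ x ∈ U, (x ∈ S.carrier ↔ f x = 0)) ∧
      (∀ x ∈ U, ∃ A : ℝ, A ≠ 0 ∧ ∀ v, fderiv ℝ f x v = A * ⟪S.ν x, v⟫) ∧
      ContDiffOn ℝ (⊤ : ℕ∞) S.ν U ∧ (∀ x ∈ U, ‖S.ν x‖ = 1) ∧
      ∀ x ∈ U, ∃ α : E3 →L[ℝ] ℝ, ∀ v w, ⟪fderiv ℝ S.ν x v, w⟫ - ⟪fderiv ℝ S.ν x w, v⟫
        = ⟪S.ν x, w⟫ * α v - ⟪S.ν x, v⟫ * α w := by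
  obtain ⟨U, hU, hpU, f, hf, hzero, hν⟩ := S.localDef p hp
  have hG : ContDiffOn ℝ (⊤ : ℕ∞) (gradient f) U :=
    (InnerProductSpace.toDual ℝ E3).symm.contDiff.comp_contDiffOn
      (hf.fderiv_of_isOpen hU (by simp))
  have ha : ContDiffOn ℝ (⊤ : ℕ∞) (fun x => ‖gradient f x‖⁻¹) U :=
    (hG.norm ℝ fun x hx => (hν x hx).1).inv fun x hx => norm_ne_zero_iff.2 (hν x hx).1
  have hsm : ContDiffOn ℝ (⊤ : ℕ∞) S.ν U := (ha.smul hG).congr fun x hx => (hν x hx).2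
  refine ⟨U, hU, hpU, f, hf, hzero, fun x hx => ⟨‖gradient f x‖, ?_, fun v => ?_⟩, hsm,
    fun x hx => ?_, fun x hx => ?_⟩
  · exact norm_ne_zero_iff.2 (hν x hx).1
  · have h0 := norm_ne_zero_iff.2 (hν x hx).1
    rw [(hν x hx).2, inner_smul_left, inner_gradient_left, conj_trivial]
    field_simp
  · have h0 := norm_ne_zero_iff.2 (hν x hx).1
    rw [(hν x hx).2, norm_smul, norm_inv, norm_norm, inv_mul_cancel₀ h0]
  · have hx' := hU.mem_nhds hx
    have h0 := norm_ne_zero_iff.2 (hν x hx).1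
    have hGd := ((hG.contDiffAt hx').differentiableAt (by simp)).hasFDerivAt
    have had := ((ha.contDiffAt hx').differentiableAt (by simp)).hasFDerivAt
    have hνd : fderiv ℝ S.ν x = _ := ((had.smul hGd).congr_of_eventuallyEq (by
      filter_upwards [hx'] with t ht using (hν t ht).2)).fderiv
    have hf2 := (((hf.fderiv_of_isOpen hU (m := (⊤ : ℕ∞)) (by simp)).contDiffAt
      hx').differentiableAt (by simp)).hasFDerivAt
    have hGv (v w : E3) : ⟪fderiv ℝ (gradient f) x v, w⟫ = fderiv ℝ (fderiv ℝ f) x v w := by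
      have h1 := hGd.inner ℝ (hasFDerivAt_const w x)
      have h2 := hf2.clm_apply (hasFDerivAt_const w x)
      simp only [inner_gradient_left] at h1
      simpa [fderivInnerCLM_apply] using congrArg (fun L : E3 →L[ℝ] ℝ => L v) (h1.unique h2)
    have hsymm : IsSymmSndFDerivAt ℝ f x :=
      (hf.contDiffAt hx').isSymmSndFDerivAt (by
        rw [minSmoothness_of_isRCLikeNormedField]
        exact WithTop.coe_le_coe.2 (le_top (a := (2 : ℕ∞))))
    refine ⟨‖gradient f x‖ • fderiv ℝ (fun x => ‖gradient f x‖⁻¹) x, fun v w => ?_⟩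
    rw [hνd, (hν x hx).2]
    simp only [add_apply, smul_apply, ContinuousLinearMap.smulRight_apply, inner_add_left,
      inner_smul_left, conj_trivial, hGv, hsymm v w, smul_eq_mul]
    field_simp
    ring

lemma exists_graph_equiv (b : OrthonormalBasis (Fin 3) ℝ E3) {n : E3} (hn : ⟪n, b 2⟫ ≠ 0)
    {A : ℝ} (hA : A ≠ 0) {D : E3 →L[ℝ] ℝ} (hD : ∀ v, D v = A * ⟪n, v⟫) :
    ∃ L : E3 ≃L[ℝ] E2 × ℝ, (L : E3 →L[ℝ] E2 × ℝ) = (graphProj b).prod D ∧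
      ∀ w, L.symm (w, 0) = graphDeriv b n w := by
  have hinj : Function.Injective ((graphProj b).prod D : E3 →ₗ[ℝ] E2 × ℝ) := by
    rw [← LinearMap.ker_eq_bot, LinearMap.ker_eq_bot']
    intro v hv
    obtain ⟨hv1, hv2⟩ := Prod.mk.inj hv
    have hj (j : Fin 2) : ⟪b j.castSucc, v⟫ = 0 := by
      simpa using congrArg (fun w : E2 => w j) hv1
    have h0 : ⟪v, b 0⟫ = 0 := by rw [real_inner_comm]; exact hj 0
    have h1 : ⟪v, b 1⟫ = 0 := by rw [real_inner_comm]; exact hj 1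
    have h2 : ⟪v, b 2⟫ = 0 := by
      have h3 : A * ⟪n, v⟫ = 0 := (hD v).symm.trans hv2
      rw [inner_eq_sum_three b, h0, h1] at h3
      simpa [hA, hn] using h3
    rw [← inner_self_eq_zero (𝕜 := ℝ), inner_eq_sum_three b, h0, h1, h2]
    simp
  have hL : ((LinearMap.linearEquivOfInjective _ hinj (by simp)).toContinuousLinearEquiv :
      E3 →L[ℝ] E2 × ℝ) = (graphProj b).prod D := by
    ext v <;> rfl
  refine ⟨_, hL, fun w => ?_⟩
  rw [ContinuousLinearEquiv.symm_apply_eq]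
  refine Eq.trans ?_ (congrArg (fun L : E3 →L[ℝ] E2 × ℝ => L (graphDeriv b n w)) hL).symm
  simp [graphProj_graphDeriv, hD, inner_graphDeriv b hn]

lemma exists_orthonormalBasis_eq {n : E3} (hn : ‖n‖ = 1) :
    ∃ b : OrthonormalBasis (Fin 3) ℝ E3, b 2 = n := by
  obtain ⟨b, hb⟩ := Orthonormal.exists_orthonormalBasis_extension_of_card_eq (𝕜 := ℝ) (E := E3)
    (ι := Fin 3) (by simp) (v := fun _ => n) (s := {2})
    ⟨fun _ => hn, fun i j hij => (hij (Subsingleton.elim i j)).elim⟩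
  exact ⟨b, hb 2 rfl⟩

/-- Every point of the surface lies in a graph chart. -/
lemma exists_graphChart (S : Surface3) {p : E3} (hp : p ∈ S.carrier) :
    ∃ c : GraphChart S, p ∈ c.U := by
  obtain ⟨U, hU, hpU, f, hf, hzero, hdf, hν, hnorm, hsymm⟩ := S.exists_smooth_normal hp
  obtain ⟨b, hb⟩ := exists_orthonormalBasis_eq (hnorm p hpU)
  have hpos : 0 < ⟪S.ν p, b 2⟫ := by
    rw [hb, real_inner_self_eq_norm_sq, hnorm p hpU]
    norm_num
  have hstrict : ∀ x ∈ U, 0 < ⟪S.ν x, b 2⟫ → ∃ L : E3 ≃L[ℝ] E2 × ℝ,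
      HasStrictFDerivAt (fun x => (graphProj b x, f x)) (L : E3 →L[ℝ] E2 × ℝ) x ∧
      ∀ w, L.symm (w, 0) = graphDeriv b (S.ν x) w := by
    intro x hx hxpos
    obtain ⟨A, hA, hD⟩ := hdf x hx
    obtain ⟨L, hL, hLs⟩ := exists_graph_equiv b hxpos.ne' hA hD
    refine ⟨L, ?_, hLs⟩
    rw [hL]
    exact (graphProj b).hasStrictFDerivAt.prodMk
      ((hf.contDiffAt (hU.mem_nhds hx)).hasStrictFDerivAt (by simp))
  obtain ⟨L₀, hL₀, -⟩ := hstrict p hpU hpos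
  set e := hL₀.toOpenPartialHomeomorph with he
  have he_apply (x : E3) : e x = (graphProj b x, f x) :=
    congrFun hL₀.toOpenPartialHomeomorph_coe x
  have hW : IsOpen (U ∩ {x | 0 < ⟪S.ν x, b 2⟫} ∩ e.source) :=
    (ContinuousOn.isOpen_inter_preimage (f := fun x => ⟪S.ν x, b 2⟫)
      (hν.continuousOn.inner continuousOn_const) hU isOpen_Ioi).inter e.open_source
  refine ⟨{ b := b
            U := U ∩ {x | 0 < ⟪S.ν x, b 2⟫} ∩ e.source
            V := (fun y : E2 => (y, (0 : ℝ))) ⁻¹' (e.target ∩ e.symm ⁻¹'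
              (U ∩ {x | 0 < ⟪S.ν x, b 2⟫} ∩ e.source))
            g := fun y => e.symm (y, 0)
            isOpen_U := hW
            isOpen_V := (e.isOpen_inter_preimage_symm hW).preimage (by fun_prop)
            g_mem := ?_
            proj_g := ?_
            proj_mem := ?_
            g_proj := ?_
            normal_pos := fun x hx => hx.1.2
            normal_norm := fun x hx => hnorm x hx.1.1
            normal_smooth := hν.mono fun x hx => hx.1.1
            normal_symm := fun x hx => hsymm x hx.1.1
            hasStrictFDerivAt := ?_ }, ⟨hpU, hpos⟩, hL₀.mem_toOpenPartialHomeomorph_source⟩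
  · rintro y ⟨hy, hyU⟩
    have h := (he_apply _).symm.trans (e.right_inv hy)
    exact ⟨(hzero _ hyU.1.1).2 (Prod.mk.inj h).2, hyU⟩
  · rintro y ⟨hy, -⟩
    exact (Prod.mk.inj ((he_apply _).symm.trans (e.right_inv hy))).1
  · rintro x ⟨hx, hxU⟩
    have h : e x = (graphProj b x, 0) := by rw [he_apply, (hzero x hxU.1.1).1 hx]
    refine ⟨?_, ?_⟩
    · have h1 := e.map_source hxU.2
      rw [h] at h1
      exact h1
    · have h1 := hxU
      rw [← e.left_inv hxU.2, h] at h1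
      exact h1
  · rintro x ⟨hx, hxU⟩
    have h : e x = (graphProj b x, 0) := by rw [he_apply, (hzero x hxU.1.1).1 hx]
    rw [← h, e.left_inv hxU.2]
  · rintro y ⟨hy, hyU⟩
    obtain ⟨L, hL, hLs⟩ := hstrict _ hyU.1.1 hyU.1.2
    have h1 : HasStrictFDerivAt e (L : E3 →L[ℝ] E2 × ℝ) (e.symm (y, 0)) := by
      rw [he, hL₀.toOpenPartialHomeomorph_coe]
      exact hL
    have h0 : HasStrictFDerivAt (fun y : E2 => (y, (0 : ℝ))) (ContinuousLinearMap.inl ℝ E2 ℝ) y :=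
      (ContinuousLinearMap.inl ℝ E2 ℝ).hasStrictFDerivAt
    have h2 := HasStrictFDerivAt.comp y (e.hasStrictFDerivAt_symm hy h1) h0
    exact h2.congr_fderiv (ContinuousLinearMap.ext hLs)

lemma exists_smooth_partition {ι : Type*} [Fintype ι] {K : Set E3} (hK : IsCompact K)
    {U : ι → Set E3} (hU : ∀ i, IsOpen (U i)) (hKU : K ⊆ ⋃ i, U i) :
    ∃ η : ι → E3 → ℝ, (∀ i, ContDiff ℝ 1 (η i)) ∧ (∀ i, tsupport (η i) ⊆ U i) ∧
      ∀ x ∈ K, ∀ᶠ y in nhds x, ∑ i, η i y = 1 := by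
  obtain ⟨L, hL, hKL, hLU⟩ := exists_compact_between hK (isOpen_iUnion hU) hKU
  obtain ⟨η, hη⟩ := SmoothPartitionOfUnity.exists_isSubordinate (modelWithCornersSelf ℝ E3)
    hL.isClosed U hU hLU
  refine ⟨fun i => η i, fun i => ?_, hη, fun x hx => ?_⟩
  · exact (contMDiff_iff_contDiff.1 (η i).contMDiff).of_le
      (WithTop.coe_le_coe.2 (le_top (a := (1 : ℕ∞))))
  · filter_upwards [isOpen_interior.mem_nhds (hKL hx)] with y hy
    rw [← finsum_eq_sum_of_fintype]
    exact η.sum_eq_one (interior_subset hy)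

lemma shrinkerDiv_sum (S : Surface3) {ι : Type*} [Fintype ι] {ζ : E3 → ℝ} {η : ι → E3 → ℝ} {x : E3}
    (hη : ∀ i, DifferentiableAt ℝ (η i) x) (h : ζ =ᶠ[nhds x] fun y => ∑ i, η i y) :
    shrinkerDiv S ζ x = ∑ i, shrinkerDiv S (η i) x := by
  simp only [shrinkerDiv]
  rw [h.fderiv_eq, h.eq_of_nhds, fderiv_fun_sum fun i _ => hη i, Finset.sum_add_distrib,
    ← Finset.sum_mul]
  simp

/-- The divergence theorem for the position field on a self-shrinker. -/
theorem integral_shrinkerDiv {S : Surface3} (hS : IsShrinker S) (hclosed : IsClosed S.carrier)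
    {ζ : E3 → ℝ} (hζ : ContDiff ℝ 1 ζ) (hζc : HasCompactSupport ζ) :
    IntegrableOn (shrinkerDiv S ζ) S.carrier μH[2] ∧
      ∫ x in S.carrier, shrinkerDiv S ζ x ∂μH[2] = 0 := by
  choose c hc using fun p : S.carrier => exists_graphChart S p.2
  have hK : IsCompact (S.carrier ∩ tsupport ζ) := IsCompact.inter_left hζc hclosed
  obtain ⟨t, ht⟩ := hK.elim_finite_subcover (fun p => (c p).U) (fun p => (c p).isOpen_U)
    fun x hx => Set.mem_iUnion.2 ⟨⟨x, hx.1⟩, hc _⟩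
  obtain ⟨η, hη, hηU, hη1⟩ := exists_smooth_partition hK (U := fun p : t => (c p).U)
    (fun p => (c p).isOpen_U) (by simpa only [Set.iUnion_coe_set, Set.iUnion_subtype] using ht)
  have hsub (p : t) : tsupport (fun x => η p x * ζ x) ⊆ tsupport ζ := tsupport_mul_subset_right
  have hdiff (p : t) : ContDiff ℝ 1 fun x => η p x * ζ x := (hη p).mul hζ
  have hloc (p : t) := (c p).integral_shrinkerDiv hS hclosed (hdiff p)
    (IsCompact.of_isClosed_subset hζc (isClosed_tsupport _) (hsub p))
    (tsupport_mul_subset_left.trans (hηU p))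
  have hsum : Set.EqOn (shrinkerDiv S ζ) (fun x => ∑ p, shrinkerDiv S (fun x => η p x * ζ x) x)
      S.carrier := fun x hx => by
    by_cases hxs : x ∈ tsupport ζ
    · refine shrinkerDiv_sum S (fun p => (hdiff p).differentiable one_ne_zero x) ?_
      filter_upwards [hη1 x ⟨hx, hxs⟩] with y hy
      rw [← Finset.sum_mul, hy, one_mul]
    · dsimp only
      rw [shrinkerDiv_eq_zero hxs, Finset.sum_eq_zero fun p _ =>
        shrinkerDiv_eq_zero fun h => hxs (hsub p h)]
  rw [integrableOn_congr_fun hsum hclosed.measurableSet,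
    setIntegral_congr_fun hclosed.measurableSet hsum,
    integral_finsetSum _ fun p _ => (hloc p).1]
  exact ⟨integrable_finsetSum _ fun p _ => (hloc p).1, Finset.sum_eq_zero fun p _ => (hloc p).2⟩

lemma hasDerivAt_max_zero_sq (u : ℝ) : HasDerivAt (fun u : ℝ => max u 0 ^ 2) (2 * max u 0) u := by
  rcases lt_trichotomy u 0 with hu | rfl | hu
  · rw [max_eq_right hu.le, mul_zero]
    refine (hasDerivAt_const u (0 : ℝ)).congr_of_eventuallyEq ?_
    filter_upwards [Iio_mem_nhds hu] with v hv
    rw [max_eq_right (Set.mem_Iio.1 hv).le, zero_pow two_ne_zero]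
  · rw [max_self, mul_zero, hasDerivAt_iff_isLittleO_nhds_zero]
    have h : (fun h : ℝ => h ^ 2) =o[nhds 0] fun h => h := by
      simpa using Asymptotics.isLittleO_pow_pow (𝕜 := ℝ) (one_lt_two)
    refine (Asymptotics.IsBigO.of_bound' (Filter.Eventually.of_forall fun v => ?_)).trans_isLittleO h
    rcases le_total v 0 with hv | hv <;> simp [hv, sq_nonneg]
  · rw [max_eq_left hu.le]
    refine HasDerivAt.congr_of_eventuallyEq (f := fun v => v ^ 2)
      (by simpa using hasDerivAt_pow 2 u) ?_
    filter_upwards [Ioi_mem_nhds hu] with v hv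
    rw [max_eq_left (Set.mem_Ioi.1 hv).le]

/-- A radial cutoff profile whose weighted divergence is controlled: `s` stands for `‖x‖ ^ 2` and
`q` for the square of the normal component of `x`. -/
lemma exists_cutoff_profile {T : ℝ} (hT : 32 ≤ T) : ∃ ψ ψ' : ℝ → ℝ, Continuous ψ' ∧
    (∀ s, HasDerivAt ψ (ψ' s) s) ∧ (∀ s, T ≤ s → ψ s = 0) ∧
    ∀ s q, 0 ≤ q → q ≤ s → 2 * ψ' s * (s - q) + ψ s * (2 - 1 / 2 * q)
      ≤ (if s ≤ 16 then T else 0) - if s ≤ T / 2 then 1 else 0 := by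
  have hT0 : 0 < T := by linarith
  have hp (s : ℝ) := hasDerivAt_max_zero_sq s
  have hpa (a s : ℝ) : HasDerivAt (fun s : ℝ => max (a - s) 0 ^ 2) (2 * max (a - s) 0 * (-1)) s :=
    (hp (a - s)).comp s ((hasDerivAt_id s).const_sub a)
  have hpb (a s : ℝ) : HasDerivAt (fun s : ℝ => max (s - a) 0 ^ 2) (2 * max (s - a) 0 * 1) s :=
    HasDerivAt.comp (h₂ := fun u : ℝ => max u 0 ^ 2) (h := fun s => s - a) s (hp (s - a))
      ((hasDerivAt_id s).sub_const a)
  have hden (s : ℝ) : 0 < s + max (16 - s) 0 ^ 2 := by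
    rcases le_total s 16 with hs | hs
    · rw [max_eq_left (by linarith)]
      nlinarith [sq_nonneg (2 * s - 31)]
    · rw [max_eq_right (by linarith)]
      linarith
  set g : ℝ → ℝ := fun s => 1 / 8 - s / 256 + max (s - 16) 0 ^ 2 / (s + max (16 - s) 0 ^ 2) / 256
    with hg
  set g' : ℝ → ℝ := fun s => -1 / 256 + (2 * max (s - 16) 0 * 1 * (s + max (16 - s) 0 ^ 2)
    - max (s - 16) 0 ^ 2 * (1 + 2 * max (16 - s) 0 * (-1))) / (s + max (16 - s) 0 ^ 2) ^ 2 / 256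
    with hg'
  have hgd (s : ℝ) : HasDerivAt g (g' s) s := by
    have h1 := (((hasDerivAt_id s).div_const 256).const_sub (1 / 8)).add
      (((hpb 16 s).div ((hasDerivAt_id s).add (hpa 16 s)) (hden s).ne').div_const 256)
    refine h1.congr_deriv ?_
    simp only [hg', neg_div, Pi.add_apply, id]
  have hg'c : Continuous g' := by
    refine continuous_const.add ((Continuous.div (by fun_prop) (by fun_prop) fun s => ?_).div_const _)
    exact (pow_pos (hden s) 2).ne'
  have hg1 (s : ℝ) (hs : s ≤ 16) : g s = 1 / 8 - s / 256 ∧ g' s = -1 / 256 := by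
    simp [hg, hg', max_eq_right (sub_nonpos.2 hs)]
  have hg2 (s : ℝ) (hs : 16 < s) : g s = 1 / s ∧ g' s = -1 / s ^ 2 := by
    have h0 : s ≠ 0 := by linarith
    simp only [hg, hg', max_eq_left (sub_nonneg.2 hs.le), max_eq_right (sub_nonpos.2 hs.le)]
    constructor <;> field_simp <;> ring
  refine ⟨fun s => max (T - s) 0 ^ 2 * g s / (2 * T), fun s =>
    (2 * max (T - s) 0 * (-1) * g s + max (T - s) 0 ^ 2 * g' s) / (2 * T), ?_, fun s => ?_,
    fun s hs => ?_, fun s q hq hqs => ?_⟩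
  · have hgc : Continuous g := continuous_iff_continuousAt.2 fun s => (hgd s).continuousAt
    fun_prop
  · exact ((hpa T s).mul (hgd s)).div_const _
  · simp [max_eq_right (sub_nonpos.2 hs)]
  · have hlin {a b C : ℝ} (h0 : 2 * a * s + b * 2 ≤ C) (h1 : b * (2 - 1 / 2 * s) ≤ C) :
        2 * a * (s - q) + b * (2 - 1 / 2 * q) ≤ C := by
      rcases (hq.trans hqs).eq_or_lt with hs | hs
      · obtain rfl : q = 0 := by linarith
        linarith
      · refine le_of_mul_le_mul_left ?_ hs
        nlinarith [mul_le_mul_of_nonneg_left h0 (sub_nonneg.2 hqs), mul_le_mul_of_nonneg_left h1 hq]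
    have hs0 := hq.trans hqs
    refine hlin ?_ ?_ <;> clear hlin hgd hg'c hpa hpb hp hden
    · have hrw : 2 * ((2 * max (T - s) 0 * (-1) * g s + max (T - s) 0 ^ 2 * g' s) / (2 * T)) * s
          + max (T - s) 0 ^ 2 * g s / (2 * T) * 2
          = (max (T - s) 0 ^ 2 * (g' s * s + g s) - 2 * max (T - s) 0 * (g s * s)) / T := by
        field_simp
        ring
      rw [hrw, div_le_iff₀ hT0]
      rcases le_or_gt s 16 with hs | hs
      · rw [(hg1 s hs).1, (hg1 s hs).2, if_pos hs, if_pos (by linarith),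
          max_eq_left (by linarith)]
        nlinarith [mul_nonneg hs0 (sq_nonneg (T - s)),
          mul_nonneg (mul_nonneg hs0 (sub_nonneg.2 hs)) (by linarith : 0 ≤ T - s)]
      · have hs' : s ≠ 0 := by linarith
        have h1 : g s * s = 1 := by rw [(hg2 s hs).1]; field_simp
        have h2 : g' s * s + g s = 0 := by rw [(hg2 s hs).1, (hg2 s hs).2]; field_simp; ring
        rw [h1, h2, if_neg hs.not_ge]
        split_ifs with h
        · rw [max_eq_left (by linarith)]
          linarith
        · have := le_max_right (T - s) 0
          linarith
    · dsimp only
      rcases le_or_gt s 16 with hs | hs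
      · rw [(hg1 s hs).1, if_pos hs, if_pos (by linarith), max_eq_left (by linarith),
          div_mul_eq_mul_div, div_le_iff₀ (by linarith)]
        have h1 : (T - s) ^ 2 ≤ T ^ 2 := by nlinarith
        have h2 : (1 / 8 - s / 256) * (2 - 1 / 2 * s) ≤ 1 / 4 := by nlinarith
        nlinarith [mul_le_mul_of_nonneg_left h2 (sq_nonneg (T - s))]
      · have hs' : 0 < s := by linarith
        rw [(hg2 s hs).1, if_neg hs.not_ge]
        split_ifs with h
        · rw [max_eq_left (by linarith)]
          have h1 : T ^ 2 / 4 ≤ (T - s) ^ 2 := by nlinarith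
          have h2 : 1 / s * (2 - 1 / 2 * s) ≤ -(3 / 8) := by
            rw [one_div_mul_eq_div, div_le_iff₀ hs']
            linarith
          have h3 : (T - s) ^ 2 * (1 / s) / (2 * T) * (2 - 1 / 2 * s)
              = (T - s) ^ 2 * (1 / s * (2 - 1 / 2 * s)) / (2 * T) := by ring
          rw [h3, div_le_iff₀ (by linarith)]
          nlinarith [mul_le_mul_of_nonneg_left h2 (sq_nonneg (T - s))]
        · rw [sub_zero]
          exact mul_nonpos_of_nonneg_of_nonpos (by positivity) (by linarith)

/-- A radial test function whose weighted divergence controls the area of a large ball by the area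
of the ball of radius `4`. -/
lemma exists_radial_testFunction (S : Surface3) {T : ℝ} (hT : 32 ≤ T) :
    ∃ ζ : E3 → ℝ, ContDiff ℝ 1 ζ ∧ HasCompactSupport ζ ∧ ∀ x ∈ S.carrier, shrinkerDiv S ζ x
      ≤ (if ‖x‖ ^ 2 ≤ 16 then T else 0) - if ‖x‖ ^ 2 ≤ T / 2 then 1 else 0 := by
  obtain ⟨ψ, ψ', hψ'c, hψ, hψ0, hineq⟩ := exists_cutoff_profile hT
  have hψ1 : ContDiff ℝ 1 ψ := contDiff_one_iff_deriv.2
    ⟨fun s => (hψ s).differentiableAt, by rwa [funext fun s => (hψ s).deriv]⟩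
  refine ⟨fun x => ψ (‖x‖ ^ 2), hψ1.comp (contDiff_norm_sq ℝ),
    HasCompactSupport.intro (isCompact_closedBall 0 T) fun x hx => hψ0 _ ?_, fun x hx => ?_⟩
  · have h1 : T < ‖x‖ := by simpa using hx
    nlinarith
  · obtain ⟨c, hc⟩ := exists_graphChart S hx
    have hd := (HasDerivAt.comp_hasFDerivAt (h₂ := ψ) x (hψ (‖x‖ ^ 2))
      (hasStrictFDerivAt_norm_sq x).hasFDerivAt).fderiv
    have hq : ⟪x, S.ν x⟫ ^ 2 ≤ ‖x‖ ^ 2 := by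
      have := abs_real_inner_le_norm x (S.ν x)
      rw [c.normal_norm x hc, mul_one] at this
      exact sq_le_sq.2 (by rwa [abs_norm])
    refine le_of_eq_of_le ?_ (hineq _ _ (sq_nonneg ⟪x, S.ν x⟫) hq)
    rw [shrinkerDiv]
    change fderiv ℝ (ψ ∘ fun x => ‖x‖ ^ 2) x _ + _ = _
    rw [hd]
    simp only [smul_apply, innerSL_apply_apply, inner_sub_right, inner_smul_right, smul_eq_mul,
      real_inner_self_eq_norm_sq, two_smul, add_apply]
    ring

/-- **Proposition 4.1 (quadratic area growth).** If `M` is a properly embedded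
self-shrinker in `ℝ³` (so that `M_t = √(-t)·M` is a mean curvature flow) with
`area(M ∩ {|x| ≤ 4}) < ∞`, then for every `k ≥ 1`,
`area(M ∩ {|x| ≤ 2k}) ≤ 8k² · area(M ∩ {|x| ≤ 4})`.  Areas are two-dimensional
Hausdorff measures. -/
theorem shrinker_area_growth
    (S : Surface3) (hS : IsShrinker S) (hclosed : IsClosed S.carrier)
    (hfin : μH[2] (S.carrier ∩ Metric.closedBall (0 : E3) 4) < ⊤) :
    ∀ k : ℝ, 1 ≤ k →
      μH[2] (S.carrier ∩ Metric.closedBall (0 : E3) (2 * k))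
        ≤ ENNReal.ofReal (8 * k ^ 2)
            * μH[2] (S.carrier ∩ Metric.closedBall (0 : E3) 4) := by
  intro k hk
  have hk2 : 1 ≤ 8 * k ^ 2 := by nlinarith
  rcases le_total k 2 with hk' | hk'
  · refine (measure_mono (Set.inter_subset_inter_right _
      (Metric.closedBall_subset_closedBall (by linarith : 2 * k ≤ 4)))).trans ?_
    exact le_mul_of_one_le_left zero_le (ENNReal.one_le_ofReal.2 hk2)
  set T := 8 * k ^ 2 with hT
  obtain ⟨ζ, hζ, hζc, hle⟩ := exists_radial_testFunction S (T := T) (by nlinarith)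
  obtain ⟨hint, hzero⟩ := integral_shrinkerDiv hS hclosed hζ hζc
  set μ := (μH[2] : Measure E3).restrict S.carrier with hμ
  have hball (r : ℝ) : μH[2] (S.carrier ∩ Metric.closedBall (0 : E3) r)
      = μ (Metric.closedBall 0 r) := by
    rw [hμ, Measure.restrict_apply measurableSet_closedBall, Set.inter_comm]
  rw [hball] at hfin
  rw [hball, hball]
  have hint4 : Integrable ((Metric.closedBall (0 : E3) 4).indicator fun _ => T) μ :=
    (integrable_indicator_iff measurableSet_closedBall).2 (integrableOn_const hfin.ne)
  have hae : ∀ᵐ x ∂μ, (Metric.closedBall (0 : E3) (2 * k)).indicator 1 x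
      ≤ (Metric.closedBall (0 : E3) 4).indicator (fun _ => T) x - shrinkerDiv S ζ x := by
    filter_upwards [ae_restrict_mem hclosed.measurableSet] with x hx
    have h4 : x ∈ Metric.closedBall (0 : E3) 4 ↔ ‖x‖ ^ 2 ≤ 16 := by
      rw [mem_closedBall_zero_iff, ← sq_le_sq₀ (norm_nonneg x) (by norm_num)]
      norm_num
    have h2k : x ∈ Metric.closedBall (0 : E3) (2 * k) ↔ ‖x‖ ^ 2 ≤ T / 2 := by
      rw [mem_closedBall_zero_iff, ← sq_le_sq₀ (norm_nonneg x) (by linarith), hT]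
      ring_nf
    have := hle x hx
    classical
    rw [Set.indicator_apply, Set.indicator_apply]
    simp only [h4, h2k, Pi.one_apply]
    split_ifs at this ⊢ <;> linarith
  calc μ (Metric.closedBall 0 (2 * k))
      = ∫⁻ x, ENNReal.ofReal ((Metric.closedBall (0 : E3) (2 * k)).indicator 1 x) ∂μ := by
        rw [← lintegral_indicator_one measurableSet_closedBall]
        congr 1 with x
        by_cases hx : x ∈ Metric.closedBall (0 : E3) (2 * k) <;> simp [hx]
    _ ≤ ∫⁻ x, ENNReal.ofReal ((Metric.closedBall (0 : E3) 4).indicator (fun _ => T) x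
          - shrinkerDiv S ζ x) ∂μ :=
        lintegral_mono_ae (hae.mono fun x hx => ENNReal.ofReal_le_ofReal hx)
    _ = ENNReal.ofReal (∫ x, (Metric.closedBall (0 : E3) 4).indicator (fun _ => T) x
          - shrinkerDiv S ζ x ∂μ) := by
        refine (ofReal_integral_eq_lintegral_ofReal (hint4.sub hint) ?_).symm
        filter_upwards [hae] with x hx
        exact (Set.indicator_nonneg (fun _ _ => zero_le_one) x).trans hx
    _ = ENNReal.ofReal T * μ (Metric.closedBall 0 4) := by
        rw [integral_sub hint4 hint, hzero, sub_zero, integral_indicator_const _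
          measurableSet_closedBall, smul_eq_mul, mul_comm, ENNReal.ofReal_mul (by linarith),
          measureReal_def, ENNReal.ofReal_toReal hfin.ne]
end
end

section
/- Let M ⊂ ℝ³ be a compact surface satisfying the shrinker equation H = ½⟨x, ν⟩, and let b ∈ ℝ³. Then ∫_M e^{−|x|²/4} ⟨b, x⟩ dA = 0. Consequently, M cannot lie strictly on one side of any plane through the origin: if ⟨b, x⟩ ≥ 0 for all x ∈ M, then ⟨b, x⟩ = 0 on M. -/
open scoped RealInnerProductSpace
open MeasureTheory
noncomputable section

instance isAddHaarMeasure_hausdorffMeasure_two :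
    (μH[2] : Measure E2).IsAddHaarMeasure := by
  simpa using MeasureTheory.isAddHaarMeasure_hausdorffMeasure (E := E2)

/-- The standard linear splitting `ℝ × ℝ² ≃ ℝ³`. -/
def splitStd : (ℝ × E2) ≃L[ℝ] E3 :=
  LinearEquiv.toContinuousLinearEquiv
    { toFun := fun z => !₂[z.1, z.2 0, z.2 1]
      invFun := fun x => (x 0, !₂[x 1, x 2])
      map_add' := fun z w => by ext i; fin_cases i <;> simp
      map_smul' := fun c z => by ext i; fin_cases i <;> simp
      left_inv := fun z => by
        refine Prod.ext (by simp) ?_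
        ext i; fin_cases i <;> simp
      right_inv := fun x => by ext i; fin_cases i <;> simp }

lemma splitStd_apply (z : ℝ × E2) : splitStd z = !₂[z.1, z.2 0, z.2 1] := rfl

/-- A Haar measure on `ℝ³` normalized so that, in every orthogonal splitting of `ℝ³` into a line
and a plane, it is the product of Lebesgue measure and two-dimensional Hausdorff measure. -/
def sliceMeasure : Measure E3 :=
  Measure.map splitStd ((volume : Measure ℝ).prod (μH[2] : Measure E2))

instance : sliceMeasure.IsAddHaarMeasure :=
  ContinuousLinearEquiv.isAddHaarMeasure_map splitStd _

lemma map_sliceMeasure_of_linearIsometryEquiv (R : E3 ≃ₗᵢ[ℝ] E3) :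
    Measure.map R sliceMeasure = sliceMeasure := by
  have h := Measure.isAddLeftInvariant_eq_smul sliceMeasure (volume : Measure E3)
  rw [h, Measure.map_smul, R.measurePreserving.map_eq]

lemma exists_orthogonal_splitting (e : E3) (he : ‖e‖ = 1) :
    ∃ J : (ℝ × E2) ≃L[ℝ] E3, (∀ z, ‖J z‖ ^ 2 = z.1 ^ 2 + ‖z.2‖ ^ 2) ∧
      (∀ z, ⟪J z, e⟫ = z.1) ∧ J (1, 0) = e ∧
      MeasurePreserving J ((volume : Measure ℝ).prod (μH[2] : Measure E2)) sliceMeasure := by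
  obtain ⟨b, hb⟩ := Orthonormal.exists_orthonormalBasis_extension_of_card_eq (𝕜 := ℝ) (E := E3)
    (ι := Fin 3) (by simp) (v := fun _ => e) (s := {0}) (by
      rw [orthonormal_iff_ite]
      rintro ⟨i, hi⟩ ⟨j, hj⟩
      simp only [Set.mem_singleton_iff] at hi hj
      subst hi; subst hj
      simp [he])
  have hb0 : b 0 = e := hb 0 rfl
  refine ⟨splitStd.trans b.repr.symm.toContinuousLinearEquiv, fun z => ?_, fun z => ?_, ?_, ?_⟩
  · simp [splitStd_apply, EuclideanSpace.norm_sq_eq, Fin.sum_univ_succ]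
  · have h1 : (splitStd.trans b.repr.symm.toContinuousLinearEquiv) z
        = b.repr.symm (splitStd z) := rfl
    have h2 : e = b.repr.symm (EuclideanSpace.single 0 1) := by simp [hb0]
    rw [h1, h2, LinearIsometryEquiv.inner_map_map]
    simp [splitStd_apply, EuclideanSpace.inner_single_right]
  · have h1 : (splitStd.trans b.repr.symm.toContinuousLinearEquiv) (1, 0)
        = b.repr.symm (splitStd (1, 0)) := rfl
    have h2 : splitStd (1, 0) = EuclideanSpace.single 0 1 := by
      ext i; fin_cases i <;> simp [splitStd_apply]
    rw [h1, h2]; simp [hb0]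
  · refine ⟨(ContinuousLinearEquiv.continuous _).measurable, ?_⟩
    have h1 : ⇑(splitStd.trans b.repr.symm.toContinuousLinearEquiv) = b.repr.symm ∘ splitStd := rfl
    rw [h1, ← Measure.map_map b.repr.symm.continuous.measurable splitStd.continuous.measurable]
    exact map_sliceMeasure_of_linearIsometryEquiv _

/-- Bumps on the line shrinking to the origin. -/
def shrinkingBump (n : ℕ) : ContDiffBump (0 : ℝ) where
  rIn := 1 / ((n : ℝ) + 2)
  rOut := 1 / ((n : ℝ) + 1)
  rIn_pos := by positivity
  rIn_lt_rOut := by gcongr; norm_num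

/-- A smooth approximate identity on the line. -/
def approxDelta (n : ℕ) : ℝ → ℝ := (shrinkingBump n).normed volume

lemma contDiff_approxDelta (n : ℕ) : ContDiff ℝ (⊤ : ℕ∞) (approxDelta n) :=
  (shrinkingBump n).contDiff_normed

lemma approxDelta_eq_zero {n : ℕ} {t : ℝ} (h : 1 / ((n : ℝ) + 1) ≤ |t|) :
    approxDelta n t = 0 := by
  have : t ∉ Function.support (approxDelta n) := by
    rw [approxDelta, ContDiffBump.support_normed_eq]
    simpa [shrinkingBump] using h
  simpa using this

lemma tendsto_integral_approxDelta_mul {N : ℝ → ℝ} (hN : Continuous N) :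
    Filter.Tendsto (fun n => ∫ t, approxDelta n t * N t) Filter.atTop (nhds (N 0)) := by
  have h0 : Filter.Tendsto (fun n => (shrinkingBump n).rOut) Filter.atTop (nhds 0) :=
    tendsto_one_div_add_atTop_nhds_zero_nat
  have h := ContDiffBump.convolution_tendsto_right_of_continuous (μ := volume) h0
    (hN.comp continuous_neg) 0
  simpa [MeasureTheory.convolution, approxDelta] using h

lemma inner_gradient_eq_fderiv (f : E3 → ℝ) (x v : E3) : ⟪gradient f x, v⟫ = fderiv ℝ f x v :=
  InnerProductSpace.toDual_symm_apply

lemma norm_gradient_eq (f : E3 → ℝ) (x : E3) : ‖gradient f x‖ = ‖fderiv ℝ f x‖ :=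
  (InnerProductSpace.toDual ℝ E3).symm.norm_map _

/-- The derivative of the flattening map `x ↦ x + (f x - ⟪x, e⟫) • e`. -/
def flatteningDeriv (f : E3 → ℝ) (e x : E3) : E3 →L[ℝ] E3 :=
  ContinuousLinearMap.id ℝ E3 + (fderiv ℝ f x - innerSL ℝ e).smulRight e

lemma det_flatteningDeriv (f : E3 → ℝ) {e : E3} (he : ‖e‖ = 1) (x : E3) :
    (flatteningDeriv f e x).det = fderiv ℝ f x e := by
  have h := LinearMap.transvection.det
    ((fderiv ℝ f x - innerSL ℝ e : E3 →L[ℝ] ℝ) : E3 →ₗ[ℝ] ℝ) e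
  have h2 : ((flatteningDeriv f e x : E3 →L[ℝ] E3) : E3 →ₗ[ℝ] E3) =
      LinearMap.transvection ((fderiv ℝ f x - innerSL ℝ e : E3 →L[ℝ] ℝ) : E3 →ₗ[ℝ] ℝ) e := by
    ext v : 1
    simp [flatteningDeriv, LinearMap.transvection.apply]
  rw [ContinuousLinearMap.det, h2, h]
  simp [he]

lemma hasStrictFDerivAt_flattening {f : E3 → ℝ} (e : E3) {x : E3}
    (hf : HasStrictFDerivAt f (fderiv ℝ f x) x) :
    HasStrictFDerivAt (fun x => x + (f x - ⟪e, x⟫) • e) (flatteningDeriv f e x) x := by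
  have h1 : HasStrictFDerivAt (fun x => f x - ⟪e, x⟫) (fderiv ℝ f x - innerSL ℝ e) x :=
    hf.sub (innerSL ℝ e).hasStrictFDerivAt
  exact (hasStrictFDerivAt_id x).add (h1.smul_const e)

/-- Near a regular point, `f` can be flattened along the direction `e` of its gradient, with
density and bi-Lipschitz constants on level sets as close to `1` as desired. -/
lemma exists_flattening {f : E3 → ℝ} {U : Set E3} (hU : IsOpen U)
    (hf : ContDiffOn ℝ (⊤ : ℕ∞) f U) {p : E3} (hp : p ∈ U) (hdf : fderiv ℝ f p ≠ 0)
    {a : ℝ} (ha : 1 < a) :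
    ∃ e : E3, ‖e‖ = 1 ∧ ∃ Φ : OpenPartialHomeomorph E3 E3, p ∈ Φ.source ∧ Φ.source ⊆ U ∧
      (∀ x, Φ x = x + (f x - ⟪e, x⟫) • e) ∧
      (∀ x ∈ Φ.source, 0 < fderiv ℝ f x e ∧ ‖fderiv ℝ f x‖ ≤ a * fderiv ℝ f x e) ∧
      ∀ x ∈ Φ.source, ∀ y ∈ Φ.source, f x = f y →
        ‖x - y‖ ^ 2 ≤ a * (‖x - y‖ ^ 2 - ⟪e, x - y⟫ ^ 2) := by
  have hfp : ContDiffAt ℝ (⊤ : ℕ∞) f p := hf.contDiffAt (hU.mem_nhds hp)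
  have hstrict : HasStrictFDerivAt f (fderiv ℝ f p) p := hfp.hasStrictFDerivAt (by simp)
  set g := ‖fderiv ℝ f p‖ with hg
  have hgpos : 0 < g := norm_pos_iff.mpr hdf
  set e : E3 := g⁻¹ • gradient f p with he_def
  have hgrad : gradient f p = g • e := by rw [he_def, smul_inv_smul₀ hgpos.ne']
  have he : ‖e‖ = 1 := by
    rw [he_def, norm_smul, norm_gradient_eq, norm_inv, Real.norm_of_nonneg hgpos.le, ← hg,
      inv_mul_cancel₀ hgpos.ne']
  have hfd : ∀ v, fderiv ℝ f p v = g * ⟪e, v⟫ := fun v => by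
    rw [← inner_gradient_eq_fderiv, hgrad, real_inner_smul_left]
  have hfde : fderiv ℝ f p e = g := by rw [hfd, real_inner_self_eq_norm_sq, he]; simp
  have hcont : ContinuousAt (fderiv ℝ f) p :=
    (hfp.fderiv_right (m := 0) (by norm_num)).continuousAt
  have hconte : ContinuousAt (fun x => fderiv ℝ f x e) p := hcont.clm_apply continuousAt_const
  have hev1 : ∀ᶠ x in nhds p, 0 < fderiv ℝ f x e :=
    hconte.eventually_const_lt (show 0 < fderiv ℝ f p e by rw [hfde]; exact hgpos)
  have hev2 : ∀ᶠ x in nhds p, ‖fderiv ℝ f x‖ < a * fderiv ℝ f x e :=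
    hcont.norm.eventually_lt (hconte.const_mul a) (by
      rw [hfde, ← hg]; nlinarith)
  have hδ : 0 < 1 - 1 / a := by
    have : 1 / a < 1 := by rw [div_lt_one (by linarith)]; exact ha
    linarith
  have hsq := Real.sqrt_pos.mpr hδ
  have hev3 := exists_nhds_square (hstrict.isLittleO.def (mul_pos hgpos hsq))
  obtain ⟨V, hVo, hpV, hV⟩ := hev3
  obtain ⟨W, hW, hWo, hpW⟩ := mem_nhds_iff.mp (hev1.and hev2)
  have hdet : (flatteningDeriv f e p).det ≠ 0 := by
    rw [det_flatteningDeriv f he, hfde]; exact hgpos.ne'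
  have hΦ : HasStrictFDerivAt (fun x => x + (f x - ⟪e, x⟫) • e)
      (((flatteningDeriv f e p).toContinuousLinearEquivOfDetNeZero hdet : E3 ≃L[ℝ] E3) :
        E3 →L[ℝ] E3) p := by
    simpa using hasStrictFDerivAt_flattening e hstrict
  have hO : IsOpen (U ∩ V ∩ W) := (hU.inter hVo).inter hWo
  refine ⟨e, he, (hΦ.toOpenPartialHomeomorph _).restrOpen (U ∩ V ∩ W) hO, ?_, ?_, ?_, ?_, ?_⟩
  · exact ⟨hΦ.mem_toOpenPartialHomeomorph_source, ⟨hp, hpV⟩, hpW⟩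
  · exact fun x hx => hx.2.1.1
  · exact fun x => rfl
  · exact fun x hx => ⟨(hW hx.2.2).1, (hW hx.2.2).2.le⟩
  · intro x hx y hy hxy
    have h : (x, y) ∈ V ×ˢ V := ⟨hx.2.1.2, hy.2.1.2⟩
    have h1 := hV h
    simp only [Set.mem_ofPred_eq, hxy, sub_self, zero_sub, norm_neg] at h1
    rw [hfd, Real.norm_eq_abs, abs_mul, abs_of_pos hgpos, mul_assoc] at h1
    have h2 := le_of_mul_le_mul_left h1 hgpos
    have h3 : ⟪e, x - y⟫ ^ 2 ≤ (1 - 1 / a) * ‖x - y‖ ^ 2 := by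
      rw [← sq_abs, ← Real.sq_sqrt hδ.le, ← mul_pow]
      gcongr
    have h4 : a * (1 - 1 / a) = a - 1 := by field_simp
    nlinarith [sq_nonneg ‖x - y‖]

/-- Transport of a compactly supported function by an open partial homeomorphism, extended by
zero. -/
def transport (Φ : OpenPartialHomeomorph E3 E3) (h : E3 → ℝ) (z : E3) : ℝ :=
  open scoped Classical in if z ∈ Φ.target then h (Φ.symm z) else 0

section transport

variable {Φ : OpenPartialHomeomorph E3 E3} {h : E3 → ℝ}

lemma transport_apply {x : E3} (hx : x ∈ Φ.source) : transport Φ h (Φ x) = h x := by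
  rw [transport, if_pos (Φ.map_source hx), Φ.left_inv hx]

lemma transport_eq_zero {z : E3} (hz : z ∉ Φ.target) : transport Φ h z = 0 := if_neg hz

lemma transport_eq_zero_of_notMem_image {z : E3} (hz : z ∉ Φ '' tsupport h) :
    transport Φ h z = 0 := by
  by_cases hzt : z ∈ Φ.target
  · rw [transport, if_pos hzt]
    refine image_eq_zero_of_notMem_tsupport fun hmem => hz ⟨_, hmem, Φ.right_inv hzt⟩
  · exact transport_eq_zero hzt

lemma isCompact_image_tsupport (hc : HasCompactSupport h) (hs : tsupport h ⊆ Φ.source) :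
    IsCompact (Φ '' tsupport h) :=
  hc.isCompact.image_of_continuousOn (Φ.continuousOn.mono hs)

lemma tsupport_transport_subset (hc : HasCompactSupport h) (hs : tsupport h ⊆ Φ.source) :
    tsupport (transport Φ h) ⊆ Φ '' tsupport h := by
  refine closure_minimal (fun z hz => ?_) (isCompact_image_tsupport hc hs).isClosed
  by_contra hz'
  exact hz (transport_eq_zero_of_notMem_image hz')

lemma hasCompactSupport_transport (hc : HasCompactSupport h) (hs : tsupport h ⊆ Φ.source) :
    HasCompactSupport (transport Φ h) :=
  (isCompact_image_tsupport hc hs).of_isClosed_subset (isClosed_tsupport _)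
    (tsupport_transport_subset hc hs)

lemma continuous_transport (hcont : Continuous h) (hc : HasCompactSupport h)
    (hs : tsupport h ⊆ Φ.source) : Continuous (transport Φ h) := by
  refine continuous_of_tsupport fun z hz => ?_
  obtain ⟨x, hx, rfl⟩ := tsupport_transport_subset hc hs hz
  have hxt : Φ x ∈ Φ.target := Φ.map_source (hs hx)
  have h1 : ContinuousAt (h ∘ Φ.symm) (Φ x) :=
    hcont.continuousAt.comp (Φ.symm.continuousAt hxt)
  refine h1.congr ?_
  filter_upwards [Φ.open_target.mem_nhds hxt] with z hz
  simp [transport, hz]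

end transport

/-- A flattening chart for the level sets of `f`, together with the orthogonal splitting in which
it is a graph chart. The parameter `r` bounds the distortion on level sets. -/
structure FlatChart (f : E3 → ℝ) (r : NNReal) where
  e : E3
  Φ : OpenPartialHomeomorph E3 E3
  J : (ℝ × E2) ≃L[ℝ] E3
  norm_e : ‖e‖ = 1
  Φ_apply : ∀ x, Φ x = x + (f x - ⟪e, x⟫) • e
  one_le_r : 1 ≤ r
  diff : ∀ x ∈ Φ.source, ContDiffAt ℝ (⊤ : ℕ∞) f x
  density_pos : ∀ x ∈ Φ.source, 0 < fderiv ℝ f x e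
  density_le : ∀ x ∈ Φ.source, ‖fderiv ℝ f x‖ ≤ (r : ℝ) ^ 2 * fderiv ℝ f x e
  lipschitz : ∀ x ∈ Φ.source, ∀ y ∈ Φ.source, f x = f y →
    ‖x - y‖ ^ 2 ≤ (r : ℝ) ^ 2 * (‖x - y‖ ^ 2 - ⟪e, x - y⟫ ^ 2)
  norm_J : ∀ z, ‖J z‖ ^ 2 = z.1 ^ 2 + ‖z.2‖ ^ 2
  inner_J : ∀ z, ⟪J z, e⟫ = z.1
  J_one : J (1, 0) = e
  measurePreserving : MeasurePreserving J ((volume : Measure ℝ).prod (μH[2] : Measure E2))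
    sliceMeasure

lemma exists_flatChart {f : E3 → ℝ} {U : Set E3} (hU : IsOpen U)
    (hf : ContDiffOn ℝ (⊤ : ℕ∞) f U) {p : E3} (hp : p ∈ U) (hdf : fderiv ℝ f p ≠ 0)
    {r : NNReal} (hr : 1 < r) : ∃ C : FlatChart f r, p ∈ C.Φ.source ∧ C.Φ.source ⊆ U := by
  have hr2 : (1 : ℝ) < (r : ℝ) ^ 2 := one_lt_pow₀ (by exact_mod_cast hr) two_ne_zero
  obtain ⟨e, he, Φ, hpΦ, hΦU, hΦ, hd, hl⟩ := exists_flattening hU hf hp hdf hr2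
  obtain ⟨J, hJn, hJi, hJe, hJm⟩ := exists_orthogonal_splitting e he
  exact ⟨⟨e, Φ, J, he, hΦ, hr.le, fun x hx => hf.contDiffAt (hU.mem_nhds (hΦU hx)),
    fun x hx => (hd x hx).1, fun x hx => (hd x hx).2, hl, hJn, hJi, hJe, hJm⟩, hpΦ, hΦU⟩

namespace FlatChart

variable {f : E3 → ℝ} {r : NNReal} (C : FlatChart f r)

/-- Orthogonal projection to the parameter plane of the chart. -/
def proj (x : E3) : E2 := (C.J.symm x).2

/-- The graph parametrization of the zero set of `f`. -/
def param (y : E2) : E3 := C.Φ.symm (C.J (0, y))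

/-- The parameter domain of the chart. -/
def domain : Set E2 := {y | C.J (0, y) ∈ C.Φ.target}

lemma continuous_J_slice : Continuous fun y : E2 => C.J (0, y) :=
  C.J.continuous.comp (by fun_prop)

lemma continuous_proj : Continuous C.proj := continuous_snd.comp C.J.symm.continuous

lemma isOpen_domain : IsOpen C.domain := C.Φ.open_target.preimage C.continuous_J_slice

lemma J_symm_fst (x : E3) : (C.J.symm x).1 = ⟪C.e, x⟫ := by
  rw [real_inner_comm]; simpa using (C.inner_J (C.J.symm x)).symm

lemma J_symm_Φ (x : E3) : C.J.symm (C.Φ x) = (f x, C.proj x) := by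
  have h1 : C.J.symm C.e = (1, 0) := by rw [← C.J_one]; simp
  rw [C.Φ_apply, map_add, map_smul, h1]
  refine Prod.ext ?_ ?_
  · simp [J_symm_fst]
  · simp [proj]

lemma Φ_eq (x : E3) : C.Φ x = C.J (f x, C.proj x) := by
  rw [← J_symm_Φ]; simp

lemma inner_Φ (x : E3) : ⟪C.e, C.Φ x⟫ = f x := by
  rw [← J_symm_fst, J_symm_Φ]

lemma param_mem {y : E2} (hy : y ∈ C.domain) : C.param y ∈ C.Φ.source := C.Φ.map_target hy

lemma Φ_param {y : E2} (hy : y ∈ C.domain) : C.Φ (C.param y) = C.J (0, y) := C.Φ.right_inv hy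

lemma f_param {y : E2} (hy : y ∈ C.domain) : f (C.param y) = 0 := by
  have := C.J_symm_Φ (C.param y)
  rw [C.Φ_param hy, ContinuousLinearEquiv.symm_apply_apply] at this
  exact (congrArg Prod.fst this).symm

lemma proj_param {y : E2} (hy : y ∈ C.domain) : C.proj (C.param y) = y := by
  have := C.J_symm_Φ (C.param y)
  rw [C.Φ_param hy, ContinuousLinearEquiv.symm_apply_apply] at this
  exact (congrArg Prod.snd this).symm

lemma J_proj {x : E3} (h0 : f x = 0) : C.J (0, C.proj x) = C.Φ x := by rw [Φ_eq, h0]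

lemma proj_mem {x : E3} (hx : x ∈ C.Φ.source) (h0 : f x = 0) : C.proj x ∈ C.domain := by
  change C.J (0, C.proj x) ∈ C.Φ.target
  rw [C.J_proj h0]; exact C.Φ.map_source hx

lemma param_proj {x : E3} (hx : x ∈ C.Φ.source) (h0 : f x = 0) : C.param (C.proj x) = x := by
  rw [param, C.J_proj h0, C.Φ.left_inv hx]

lemma norm_sub_sq (x y : E3) :
    ‖x - y‖ ^ 2 = ⟪C.e, x - y⟫ ^ 2 + ‖C.proj x - C.proj y‖ ^ 2 := by
  have h := C.norm_J (C.J.symm (x - y))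
  rw [J_symm_fst, ContinuousLinearEquiv.apply_symm_apply] at h
  rw [h]; simp [proj]

lemma lipschitzWith_proj : LipschitzWith 1 C.proj := by
  refine LipschitzWith.of_dist_le_mul fun x y => ?_
  rw [dist_eq_norm, dist_eq_norm, NNReal.coe_one, one_mul]
  refine le_of_sq_le_sq ?_ (norm_nonneg _)
  rw [C.norm_sub_sq x y]
  nlinarith [sq_nonneg ⟪C.e, x - y⟫]

lemma lipschitzOnWith_param : LipschitzOnWith r C.param C.domain := by
  refine LipschitzOnWith.of_dist_le_mul fun x hx y hy => ?_
  have h1 := C.lipschitz _ (C.param_mem hx) _ (C.param_mem hy)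
    ((C.f_param hx).trans (C.f_param hy).symm)
  have h2 := C.norm_sub_sq (C.param x) (C.param y)
  rw [C.proj_param hx, C.proj_param hy] at h2
  rw [dist_eq_norm, dist_eq_norm]
  refine le_of_sq_le_sq ?_ (by positivity)
  rw [mul_pow]
  calc _ ≤ _ := h1
    _ = _ := by rw [h2]; ring

section measure

variable {M : Set E3} (hM : ∀ x ∈ C.Φ.source, (x ∈ M ↔ f x = 0))

/-- The area measure of `M` in the chart, pushed to the parameter plane. -/
def pushed (M : Set E3) : Measure E2 := Measure.map C.proj (μH[2].restrict (M ∩ C.Φ.source))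

lemma pushed_apply (M : Set E3) {A : Set E2} (hA : MeasurableSet A) :
    C.pushed M A = μH[2] (C.proj ⁻¹' A ∩ (M ∩ C.Φ.source)) := by
  rw [pushed, Measure.map_apply C.continuous_proj.measurable hA,
    Measure.restrict_apply (C.continuous_proj.measurable hA)]

include hM

lemma restrict_domain_le_pushed : (μH[2] : Measure E2).restrict C.domain ≤ C.pushed M := by
  refine Measure.le_iff.mpr fun A hA => ?_
  rw [C.pushed_apply M hA, Measure.restrict_apply hA]
  have hsub : A ∩ C.domain ⊆ C.proj '' (C.proj ⁻¹' A ∩ (M ∩ C.Φ.source)) := by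
    rintro y ⟨hyA, hy⟩
    have hp := C.proj_param hy
    exact ⟨C.param y, ⟨by simpa [hp] using hyA, (hM _ (C.param_mem hy)).mpr (C.f_param hy),
      C.param_mem hy⟩, hp⟩
  refine (measure_mono hsub).trans ?_
  simpa using C.lipschitzWith_proj.hausdorffMeasure_image_le (d := 2) (by norm_num)
    (C.proj ⁻¹' A ∩ (M ∩ C.Φ.source))

lemma pushed_le : C.pushed M ≤ (r ^ 2 : NNReal) • (μH[2] : Measure E2).restrict C.domain := by
  refine Measure.le_iff.mpr fun A hA => ?_
  rw [C.pushed_apply M hA, Measure.smul_apply, Measure.restrict_apply hA]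
  have hsub : C.proj ⁻¹' A ∩ (M ∩ C.Φ.source) ⊆ C.param '' (A ∩ C.domain) := by
    rintro x ⟨hxA, hxM, hx⟩
    have h0 := (hM x hx).mp hxM
    exact ⟨C.proj x, ⟨hxA, C.proj_mem hx h0⟩, C.param_proj hx h0⟩
  refine (measure_mono hsub).trans ?_
  have h := (C.lipschitzOnWith_param.mono (Set.inter_subset_right (s := A))).hausdorffMeasure_image_le
    (d := 2) (by norm_num)
  refine h.trans (le_of_eq ?_)
  rw [ENNReal.smul_def, smul_eq_mul]
  norm_num

end measure

end FlatChart

namespace FlatChart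

variable {f : E3 → ℝ} {r : NNReal} (C : FlatChart f r)

lemma inner_e_J (z : ℝ × E2) : ⟪C.e, C.J z⟫ = z.1 := by rw [real_inner_comm, C.inner_J]

lemma continuous_sliceIntegral {k : E3 → ℝ} (hk : Continuous k) (hc : HasCompactSupport k) :
    Continuous fun t => ∫ y, k (C.J (t, y)) ∂μH[2] := by
  rw [← continuousOn_univ]
  have hcomp : IsCompact (C.proj '' tsupport k) := hc.isCompact.image C.continuous_proj
  refine continuousOn_integral_of_compact_support hcomp ?_ fun t y _ hy => ?_
  · exact (hk.comp C.J.continuous).continuousOn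
  · refine image_eq_zero_of_notMem_tsupport fun hmem => hy ⟨_, hmem, ?_⟩
    simp [proj]

lemma integral_inner_mul {k : E3 → ℝ} (hk : Continuous k) (hc : HasCompactSupport k)
    {φ : ℝ → ℝ} (hφ : Continuous φ) :
    ∫ z, φ ⟪C.e, z⟫ * k z ∂sliceMeasure = ∫ t, φ t * ∫ y, k (C.J (t, y)) ∂μH[2] := by
  have hcont : Continuous fun z => φ ⟪C.e, z⟫ * k z :=
    (hφ.comp (continuous_const.inner continuous_id)).mul hk
  have hint : Integrable (fun z => φ ⟪C.e, z⟫ * k z) sliceMeasure :=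
    hcont.integrable_of_hasCompactSupport hc.mul_left
  have hemb : MeasurableEmbedding C.J := C.J.toHomeomorph.measurableEmbedding
  rw [← C.measurePreserving.integral_comp hemb, integral_prod]
  · refine integral_congr_ae (Filter.Eventually.of_forall fun t => ?_)
    simp only [C.inner_e_J, integral_const_mul]
  · exact (C.measurePreserving.integrable_comp_emb hemb).mpr hint

/-- The area density of the level sets of `f` over the parameter plane. -/
def density (x : E3) : ℝ := ‖fderiv ℝ f x‖ / fderiv ℝ f x C.e

lemma one_le_density {x : E3} (hx : x ∈ C.Φ.source) : 1 ≤ C.density x := by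
  rw [density, one_le_div (C.density_pos x hx)]
  have := (fderiv ℝ f x).le_opNorm C.e
  rw [C.norm_e, mul_one] at this
  exact (le_abs_self _).trans this

lemma density_le_sq {x : E3} (hx : x ∈ C.Φ.source) : C.density x ≤ (r : ℝ) ^ 2 := by
  rw [density, div_le_iff₀ (C.density_pos x hx)]
  exact C.density_le x hx

section weighted

variable {h : E3 → ℝ}

lemma tsupport_weighted_subset : tsupport (fun x => C.density x * h x) ⊆ tsupport h :=
  tsupport_mul_subset_right

lemma continuous_weighted (hcont : Continuous h) (hs : tsupport h ⊆ C.Φ.source) :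
    Continuous fun x => C.density x * h x := by
  refine continuous_of_tsupport fun x hx => ?_
  have hxs := hs (C.tsupport_weighted_subset hx)
  have hd : ContinuousAt (fderiv ℝ f) x :=
    ((C.diff x hxs).fderiv_right (m := 0) (by norm_num)).continuousAt
  exact (hd.norm.div (hd.clm_apply continuousAt_const) (C.density_pos x hxs).ne').mul
    hcont.continuousAt

lemma integral_comp_mul_norm_fderiv_mul (hs : tsupport h ⊆ C.Φ.source) (φ : ℝ → ℝ) :
    ∫ x, φ (f x) * (‖fderiv ℝ f x‖ * h x) ∂sliceMeasure =
      ∫ z, φ ⟪C.e, z⟫ * transport C.Φ (fun x => C.density x * h x) z ∂sliceMeasure := by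
  have hsource : ∀ x, x ∉ C.Φ.source → h x = 0 := fun x hx =>
    image_eq_zero_of_notMem_tsupport fun hmem => hx (hs hmem)
  have h1 := setIntegral_eq_integral_of_forall_compl_eq_zero (μ := sliceMeasure)
    (s := C.Φ.source) (f := fun x => φ (f x) * (‖fderiv ℝ f x‖ * h x))
    (fun x hx => by simp [hsource x hx])
  have h2 := setIntegral_eq_integral_of_forall_compl_eq_zero (μ := sliceMeasure)
    (s := C.Φ.target) (f := fun z => φ ⟪C.e, z⟫ * transport C.Φ (fun x => C.density x * h x) z)
    (fun x hx => by simp [transport_eq_zero hx])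
  rw [← h1, ← h2, ← C.Φ.image_source_eq_target,
    integral_image_eq_integral_abs_det_fderiv_smul sliceMeasure C.Φ.open_source.measurableSet
      (f' := flatteningDeriv f C.e) (fun x hx => ?_) C.Φ.injOn]
  · refine setIntegral_congr_fun C.Φ.open_source.measurableSet fun x hx => ?_
    simp only [C.inner_Φ, transport_apply hx, det_flatteningDeriv f C.norm_e,
      abs_of_pos (C.density_pos x hx), density, smul_eq_mul]
    have := (C.density_pos x hx).ne'
    field_simp
  · have h1 := hasStrictFDerivAt_flattening C.e ((C.diff x hx).hasStrictFDerivAt (by simp))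
    have h2 : (⇑C.Φ) = fun x => x + (f x - ⟪C.e, x⟫) • C.e := funext C.Φ_apply
    rw [h2]
    exact h1.hasFDerivAt.hasFDerivWithinAt

lemma tendsto_integral_approxDelta (hcont : Continuous h) (hc : HasCompactSupport h)
    (hs : tsupport h ⊆ C.Φ.source) :
    Filter.Tendsto
      (fun n => ∫ x, approxDelta n (f x) * (‖fderiv ℝ f x‖ * h x) ∂sliceMeasure) Filter.atTop
      (nhds (∫ y, transport C.Φ (fun x => C.density x * h x) (C.J (0, y)) ∂μH[2])) := by
  have hs' := (C.tsupport_weighted_subset (h := h)).trans hs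
  have hc' : HasCompactSupport fun x => C.density x * h x := hc.mul_left
  have hk := continuous_transport (C.continuous_weighted hcont hs) hc' hs'
  have hkc := hasCompactSupport_transport hc' hs'
  refine (tendsto_integral_approxDelta_mul (C.continuous_sliceIntegral hk hkc)).congr fun n => ?_
  rw [C.integral_comp_mul_norm_fderiv_mul hs,
    C.integral_inner_mul hk hkc (contDiff_approxDelta n).continuous]

end weighted

section compare

variable {M : Set E3} (hMc : IsClosed M) (hM : ∀ x ∈ C.Φ.source, (x ∈ M ↔ f x = 0))
  {h : E3 → ℝ} (hcont : Continuous h) (hc : HasCompactSupport h) (hs : tsupport h ⊆ C.Φ.source)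

include hMc hM hs hcont hc in
lemma setIntegral_eq_integral_pushed :
    ∫ x in M, h x ∂μH[2] = ∫ y, transport C.Φ h (C.J (0, y)) ∂(C.pushed M) := by
  have hmeas : MeasurableSet (M ∩ C.Φ.source) :=
    hMc.measurableSet.inter C.Φ.open_source.measurableSet
  have hk : Continuous fun y => transport C.Φ h (C.J (0, y)) :=
    (continuous_transport hcont hc hs).comp C.continuous_J_slice
  rw [pushed, integral_map C.continuous_proj.measurable.aemeasurable hk.aestronglyMeasurable,
    setIntegral_eq_of_subset_of_forall_sdiff_eq_zero hMc.measurableSet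
      Set.inter_subset_left (fun x hx => ?_)]
  · refine setIntegral_congr_fun hmeas fun x hx => ?_
    simp only [C.J_proj ((hM x hx.2).mp hx.1), transport_apply hx.2]
  · exact image_eq_zero_of_notMem_tsupport fun hmem => hx.2 ⟨hx.1, hs hmem⟩

include hcont hc hs in
lemma integrable_transport_slice : Integrable (fun y => transport C.Φ h (C.J (0, y))) μH[2] := by
  have hk := continuous_transport hcont hc hs
  refine (hk.comp C.continuous_J_slice).integrable_of_hasCompactSupport ?_
  have hcomp := (hasCompactSupport_transport hc hs).isCompact.image C.continuous_proj
  refine HasCompactSupport.intro hcomp fun y hy => ?_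
  change transport C.Φ h (C.J (0, y)) = 0
  refine image_eq_zero_of_notMem_tsupport fun hmem => hy ⟨_, hmem, ?_⟩
  simp [proj]

include hMc hM hcont hc hs in
/-- The tube integrals around `M` converge, with a limit comparable to the surface integral. -/
lemma exists_tendsto_comparable (h0 : ∀ x, 0 ≤ h x) :
    ∃ L : ℝ, Filter.Tendsto
      (fun n => ∫ x, approxDelta n (f x) * (‖fderiv ℝ f x‖ * h x) ∂sliceMeasure) Filter.atTop
      (nhds L) ∧ ∫ x in M, h x ∂μH[2] ≤ (r : ℝ) ^ 2 * L ∧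
      L ≤ (r : ℝ) ^ 2 * ∫ x in M, h x ∂μH[2] := by
  refine ⟨_, C.tendsto_integral_approxDelta hcont hc hs, ?_⟩
  rw [C.setIntegral_eq_integral_pushed hMc hM hcont hc hs]
  set κ := fun y : E2 => transport C.Φ h (C.J (0, y)) with hκ
  set κ' := fun y : E2 => transport C.Φ (fun x => C.density x * h x) (C.J (0, y)) with hκ'
  have hκi : Integrable κ μH[2] := C.integrable_transport_slice hcont hc hs
  have hκi' : Integrable κ' μH[2] := C.integrable_transport_slice
    (C.continuous_weighted hcont hs) hc.mul_left ((C.tsupport_weighted_subset (h := h)).trans hs)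
  have hκ0 : ∀ y, 0 ≤ κ y := fun y => by
    simp only [hκ, transport]; split_ifs
    · exact h0 _
    · exact le_rfl
  have hle : ∀ y, κ y ≤ κ' y := fun y => by
    simp only [hκ, hκ', transport]; split_ifs with hy
    · exact le_mul_of_one_le_left (h0 _) (C.one_le_density (C.Φ.map_target hy))
    · exact le_rfl
  have hle' : ∀ y, κ' y ≤ (r : ℝ) ^ 2 * κ y := fun y => by
    simp only [hκ, hκ', transport]; split_ifs with hy
    · exact mul_le_mul_of_nonneg_right (C.density_le_sq (C.Φ.map_target hy)) (h0 _)
    · simp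
  have hdom : ∫ y in C.domain, κ y ∂μH[2] = ∫ y, κ y ∂μH[2] :=
    setIntegral_eq_integral_of_forall_compl_eq_zero fun y hy => transport_eq_zero hy
  have hsmul : ∫ y, κ y ∂((r ^ 2 : NNReal) • (μH[2] : Measure E2).restrict C.domain) =
      (r : ℝ) ^ 2 * ∫ y, κ y ∂μH[2] := by
    rw [integral_smul_nnreal_measure, hdom]; simp [NNReal.smul_def]
  have hpi' : Integrable κ ((r ^ 2 : NNReal) • (μH[2] : Measure E2).restrict C.domain) :=
    hκi.restrict.smul_measure_nnreal
  have hpi : Integrable κ (C.pushed M) := hpi'.mono_measure (C.pushed_le hM)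
  constructor
  · calc _ ≤ ∫ y, κ y ∂((r ^ 2 : NNReal) • (μH[2] : Measure E2).restrict C.domain) :=
          integral_mono_measure (C.pushed_le hM) (Filter.Eventually.of_forall hκ0) hpi'
      _ ≤ _ := by
          rw [hsmul]
          exact mul_le_mul_of_nonneg_left (integral_mono hκi hκi' hle) (by positivity)
  · calc _ ≤ (r : ℝ) ^ 2 * ∫ y, κ y ∂μH[2] := by
          rw [← integral_const_mul]
          exact integral_mono hκi' (hκi.const_mul _) hle'
      _ ≤ _ := by
          rw [← hdom]
          exact mul_le_mul_of_nonneg_left (integral_mono_measure (C.restrict_domain_le_pushed hM)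
            (Filter.Eventually.of_forall hκ0) hpi) (by positivity)

end compare

end FlatChart

namespace FlatChart

variable {f : E3 → ℝ} {r : NNReal} (C : FlatChart f r) {M : Set E3}
  (hM : ∀ x ∈ C.Φ.source, (x ∈ M ↔ f x = 0))

include hM

lemma finiteAtFilter_nhdsWithin {p : E3} (hp : p ∈ C.Φ.source) :
    (μH[2] : Measure E3).FiniteAtFilter (nhdsWithin p M) := by
  refine ⟨M ∩ (C.Φ.source ∩ Metric.ball p 1), Filter.inter_mem self_mem_nhdsWithin
    (mem_nhdsWithin_of_mem_nhds (Filter.inter_mem (C.Φ.open_source.mem_nhds hp)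
      (Metric.ball_mem_nhds p one_pos))), ?_⟩
  have hball : MeasurableSet (Metric.ball (C.proj p) 1) := Metric.isOpen_ball.measurableSet
  calc _ ≤ C.pushed M (Metric.ball (C.proj p) 1) := by
        rw [C.pushed_apply M hball]
        refine measure_mono fun x hx => ⟨?_, hx.1, hx.2.1⟩
        have h := C.lipschitzWith_proj.dist_le_mul x p
        rw [NNReal.coe_one, one_mul] at h
        exact h.trans_lt hx.2.2
    _ ≤ _ := C.pushed_le hM _
    _ < _ := by
        rw [Measure.smul_apply, ENNReal.smul_def, smul_eq_mul, Measure.restrict_apply hball]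
        exact ENNReal.mul_lt_top ENNReal.coe_lt_top
          ((measure_mono Set.inter_subset_left).trans_lt measure_ball_lt_top)

lemma measure_inter_pos {p : E3} (hp : p ∈ C.Φ.source) (hpM : p ∈ M) {O : Set E3}
    (hO : IsOpen O) (hpO : p ∈ O) : 0 < μH[2] (M ∩ O) := by
  have h0 := (hM p hp).mp hpM
  have hA : IsOpen (C.domain ∩ C.param ⁻¹' O) :=
    C.lipschitzOnWith_param.continuousOn.isOpen_inter_preimage C.isOpen_domain hO
  have hne : (C.domain ∩ C.param ⁻¹' O).Nonempty :=
    ⟨C.proj p, C.proj_mem hp h0, by simpa [C.param_proj hp h0] using hpO⟩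
  have hsub : C.domain ∩ C.param ⁻¹' O ⊆ C.proj '' (M ∩ O) := fun y hy =>
    ⟨C.param y, ⟨(hM _ (C.param_mem hy.1)).mpr (C.f_param hy.1), hy.2⟩, C.proj_param hy.1⟩
  refine (hA.measure_pos μH[2] hne).trans_le ((measure_mono hsub).trans ?_)
  simpa using C.lipschitzWith_proj.hausdorffMeasure_image_le (d := 2) (by norm_num) (M ∩ O)

end FlatChart

open scoped Manifold ContDiff in
/-- A finite smooth partition of unity subordinate to a pointwise cover of a compact set. -/
lemma exists_finite_smooth_partition {s : Set E3} (hs : IsCompact s) {V : E3 → Set E3}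
    (hVo : ∀ p ∈ s, IsOpen (V p)) (hV : ∀ p ∈ s, p ∈ V p) :
    ∃ (t : Finset E3) (φ : t → E3 → ℝ), (∀ i : t, (i : E3) ∈ s ∧ ContDiff ℝ (⊤ : ℕ∞) (φ i) ∧
      HasCompactSupport (φ i) ∧ tsupport (φ i) ⊆ V i ∧ ∀ x, 0 ≤ φ i x) ∧
      ∀ x ∈ s, ∀ᶠ y in nhds x, ∑ i, φ i y = 1 := by
  obtain ⟨t, hts, hcov⟩ := hs.elim_nhds_subcover (fun p => V p ∩ Metric.ball p 1) fun p hp =>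
    Filter.inter_mem ((hVo p hp).mem_nhds (hV p hp)) (Metric.ball_mem_nhds p one_pos)
  have hopen : ∀ i : t, IsOpen (V i ∩ Metric.ball (i : E3) 1) := fun i =>
    (hVo _ (hts _ i.2)).inter Metric.isOpen_ball
  have hcov' : s ⊆ ⋃ i : t, V i ∩ Metric.ball (i : E3) 1 := fun x hx => by
    obtain ⟨p, hp, hxp⟩ := Set.mem_iUnion₂.mp (hcov hx)
    exact Set.mem_iUnion.mpr ⟨⟨p, hp⟩, hxp⟩
  obtain ⟨K, hK, hsK, hKc⟩ := exists_compact_between hs (isOpen_iUnion hopen) hcov'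
  obtain ⟨ρ, hρ⟩ := SmoothPartitionOfUnity.exists_isSubordinate 𝓘(ℝ, E3) hK.isClosed _ hopen hKc
  refine ⟨t, fun i => ρ i, fun i => ⟨hts _ i.2, (ρ i).contMDiff.contDiff, ?_, ?_, ρ.nonneg i⟩, ?_⟩
  · exact (isCompact_closedBall (i : E3) 1).of_isClosed_subset (isClosed_tsupport _)
      ((hρ i).trans (Set.inter_subset_right.trans Metric.ball_subset_closedBall))
  · exact (hρ i).trans Set.inter_subset_left
  · intro x hx
    filter_upwards [isOpen_interior.mem_nhds (hsK hx)] with y hy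
    rw [← finsum_eq_sum_of_fintype]
    exact ρ.sum_eq_one (interior_subset hy)

/-- `f` is a smooth defining function for `M` in the open set `U`, without critical points. -/
structure IsDefining (M : Set E3) (f : E3 → ℝ) (U : Set E3) : Prop where
  isOpen : IsOpen U
  contDiffOn : ContDiffOn ℝ (⊤ : ℕ∞) f U
  mem_iff : ∀ x ∈ U, (x ∈ M ↔ f x = 0)
  fderiv_ne_zero : ∀ x ∈ U, fderiv ℝ f x ≠ 0

namespace IsDefining

variable {M : Set E3} {f : E3 → ℝ} {U : Set E3} (hd : IsDefining M f U)
  {h : E3 → ℝ} (hcont : Continuous h) (hc : HasCompactSupport h) (hs : tsupport h ⊆ U)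

include hd

lemma integrable_tube_integrand (hcont : Continuous h) (hc : HasCompactSupport h)
    (hs : tsupport h ⊆ U) (n : ℕ) :
    Integrable (fun x => approxDelta n (f x) * (‖fderiv ℝ f x‖ * h x)) sliceMeasure := by
  refine Continuous.integrable_of_hasCompactSupport ?_ hc.mul_left.mul_left
  refine continuous_of_tsupport fun x hx => ?_
  have hx' : x ∈ tsupport h := tsupport_mul_subset_right (tsupport_mul_subset_right hx)
  have hf : ContDiffAt ℝ (⊤ : ℕ∞) f x := hd.contDiffOn.contDiffAt (hd.isOpen.mem_nhds (hs hx'))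
  have hf' : ContinuousAt (fderiv ℝ f) x := (hf.fderiv_right (m := 0) (by norm_num)).continuousAt
  exact ((contDiff_approxDelta n).continuous.continuousAt.comp hf.continuousAt).mul
    (hf'.norm.mul hcont.continuousAt)

/-- Near every point of `U`, tube integrals of nonnegative functions converge and their limits are
comparable to surface integrals. -/
lemma exists_nhds_comparable (hMc : IsClosed M) {r : NNReal} (hr : 1 < r) {p : E3} (hp : p ∈ U) :
    ∃ V : Set E3, IsOpen V ∧ p ∈ V ∧ ∀ k : E3 → ℝ, Continuous k → HasCompactSupport k →
      tsupport k ⊆ V → (∀ x, 0 ≤ k x) → ∃ L : ℝ, Filter.Tendsto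
      (fun n => ∫ x, approxDelta n (f x) * (‖fderiv ℝ f x‖ * k x) ∂sliceMeasure) Filter.atTop
      (nhds L) ∧ ∫ x in M, k x ∂μH[2] ≤ (r : ℝ) ^ 2 * L ∧
      L ≤ (r : ℝ) ^ 2 * ∫ x in M, k x ∂μH[2] := by
  by_cases hpM : p ∈ M
  · obtain ⟨C, hpC, hCU⟩ := exists_flatChart hd.isOpen hd.contDiffOn hp (hd.fderiv_ne_zero p hp) hr
    exact ⟨C.Φ.source, C.Φ.open_source, hpC, fun k hk hkc hks hk0 =>
      C.exists_tendsto_comparable hMc (fun x hx => hd.mem_iff x (hCU hx)) hk hkc hks hk0⟩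
  · have hfp : 0 < |f p| := abs_pos.mpr fun h0 => hpM ((hd.mem_iff p hp).mpr h0)
    have hV : IsOpen (U ∩ (fun x => |f x|) ⁻¹' Set.Ioi (|f p| / 2)) :=
      (hd.contDiffOn.continuousOn.abs).isOpen_inter_preimage hd.isOpen isOpen_Ioi
    refine ⟨_, hV, ⟨hp, by simpa using hfp⟩, fun k hk hkc hks hk0 => ⟨0, ?_, ?_⟩⟩
    · have hev : ∀ᶠ n : ℕ in Filter.atTop, 1 / ((n : ℝ) + 1) < |f p| / 2 :=
        tendsto_one_div_add_atTop_nhds_zero_nat.eventually_lt_const (half_pos hfp)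
      refine tendsto_const_nhds.congr' ?_
      filter_upwards [hev] with n hn
      refine (integral_eq_zero_of_ae (Filter.Eventually.of_forall fun x => ?_)).symm
      by_cases hx : x ∈ tsupport k
      · have h1 : |f p| / 2 < |f x| := (hks hx).2
        simp [approxDelta_eq_zero (hn.trans h1).le]
      · simp [image_eq_zero_of_notMem_tsupport hx]
    · have hz : ∫ x in M, k x ∂μH[2] = 0 := by
        refine setIntegral_eq_zero_of_forall_eq_zero fun x hx => ?_
        refine image_eq_zero_of_notMem_tsupport fun hmem => ?_
        have h1 : |f p| / 2 < |f x| := (hks hmem).2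
        rw [(hd.mem_iff x (hks hmem).1).mp hx, abs_zero] at h1
        linarith
      simp [hz]

/-- Tube integrals converge to surface integrals. -/
lemma tendsto_tube_of_nonneg (hMc : IsClosed M) (hfin : μH[2] M < ⊤) (hcont : Continuous h)
    (hc : HasCompactSupport h) (hs : tsupport h ⊆ U) (h0 : ∀ x, 0 ≤ h x) :
    Filter.Tendsto (fun n => ∫ x, approxDelta n (f x) * (‖fderiv ℝ f x‖ * h x) ∂sliceMeasure)
      Filter.atTop (nhds (∫ x in M, h x ∂μH[2])) := by
  have key : ∀ r : NNReal, 1 < r → ∃ L : ℝ, Filter.Tendsto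
      (fun n => ∫ x, approxDelta n (f x) * (‖fderiv ℝ f x‖ * h x) ∂sliceMeasure) Filter.atTop
      (nhds L) ∧ ∫ x in M, h x ∂μH[2] ≤ (r : ℝ) ^ 2 * L ∧
      L ≤ (r : ℝ) ^ 2 * ∫ x in M, h x ∂μH[2] := by
    intro r hr
    choose! V hVo hpV hV using fun p (hp : p ∈ tsupport h) =>
      hd.exists_nhds_comparable hMc hr (hs hp)
    obtain ⟨t, φ, hφ, hsum⟩ := exists_finite_smooth_partition hc.isCompact hVo hpV
    have hkc : ∀ i, Continuous fun x => φ i x * h x := fun i => (hφ i).2.1.continuous.mul hcont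
    have hkcs : ∀ i, HasCompactSupport fun x => φ i x * h x := fun i => hc.mul_left
    have hdecomp : ∀ x, h x = ∑ i, φ i x * h x := fun x => by
      rw [← Finset.sum_mul]
      by_cases hx : x ∈ tsupport h
      · rw [(hsum x hx).self_of_nhds, one_mul]
      · simp [image_eq_zero_of_notMem_tsupport hx]
    choose L hL hL1 hL2 using fun i : t => hV i (hφ i).1 _ (hkc i) (hkcs i)
      (tsupport_mul_subset_left.trans (hφ i).2.2.2.1)
      (fun x => mul_nonneg ((hφ i).2.2.2.2 x) (h0 x))
    have hI : ∫ x in M, h x ∂μH[2] = ∑ i, ∫ x in M, φ i x * h x ∂μH[2] := by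
      have : IsFiniteMeasure ((μH[2] : Measure E3).restrict M) := ⟨by simpa using hfin⟩
      rw [← integral_finsetSum _ fun i _ =>
        (hkc i).integrable_of_hasCompactSupport (hkcs i)]
      simp only [← hdecomp]
    refine ⟨∑ i, L i, ?_, ?_, ?_⟩
    · refine (tendsto_finsetSum _ fun i _ => hL i).congr fun n => ?_
      rw [← integral_finsetSum _ fun i _ => hd.integrable_tube_integrand (hkc i) (hkcs i)
        (tsupport_mul_subset_right.trans hs) n]
      refine integral_congr_ae (Filter.Eventually.of_forall fun x => ?_)
      simp only [← Finset.mul_sum, ← hdecomp]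
    · rw [hI, Finset.mul_sum]; exact Finset.sum_le_sum fun i _ => hL1 i
    · rw [hI, Finset.mul_sum]; exact Finset.sum_le_sum fun i _ => hL2 i
  obtain ⟨L, hL, -, -⟩ := key 2 one_lt_two
  have hall : ∀ r : NNReal, 1 < r → ∫ x in M, h x ∂μH[2] ≤ (r : ℝ) ^ 2 * L ∧
      L ≤ (r : ℝ) ^ 2 * ∫ x in M, h x ∂μH[2] := fun r hr => by
    obtain ⟨L', hL', h1, h2⟩ := key r hr
    rw [tendsto_nhds_unique hL hL']; exact ⟨h1, h2⟩
  have hlim : ∀ c : ℝ, Filter.Tendsto (fun r : NNReal => (r : ℝ) ^ 2 * c)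
      (nhdsWithin 1 (Set.Ioi 1)) (nhds c) := fun c => by
    have : Continuous fun r : NNReal => (r : ℝ) ^ 2 * c := by fun_prop
    simpa using (this.tendsto 1).mono_left nhdsWithin_le_nhds
  have hI : ∫ x in M, h x ∂μH[2] = L := le_antisymm
    (ge_of_tendsto (hlim L) (Filter.eventually_of_mem self_mem_nhdsWithin fun r hr => (hall r hr).1))
    (ge_of_tendsto (hlim _) (Filter.eventually_of_mem self_mem_nhdsWithin fun r hr => (hall r hr).2))
  rw [hI]; exact hL

/-- Tube integrals converge to surface integrals. -/
lemma tendsto_tube (hMc : IsClosed M) (hfin : μH[2] M < ⊤) (hcont : Continuous h)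
    (hc : HasCompactSupport h) (hs : tsupport h ⊆ U) :
    Filter.Tendsto (fun n => ∫ x, approxDelta n (f x) * (‖fderiv ℝ f x‖ * h x) ∂sliceMeasure)
      Filter.atTop (nhds (∫ x in M, h x ∂μH[2])) := by
  have : IsFiniteMeasure ((μH[2] : Measure E3).restrict M) := ⟨by simpa using hfin⟩
  have hposc : HasCompactSupport fun x => max (h x) 0 :=
    hc.comp_left (g := fun t => max t 0) (by simp)
  have hnegc : HasCompactSupport fun x => max (-h x) 0 :=
    hc.comp_left (g := fun t => max (-t) 0) (by simp)
  have hposs : tsupport (fun x => max (h x) 0) ⊆ U :=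
    (tsupport_comp_subset (g := fun t : ℝ => max t 0) (by simp) h).trans hs
  have hnegs : tsupport (fun x => max (-h x) 0) ⊆ U :=
    (tsupport_comp_subset (g := fun t : ℝ => max (-t) 0) (by simp) h).trans hs
  have hposcont : Continuous fun x => max (h x) 0 := by fun_prop
  have hnegcont : Continuous fun x => max (-h x) 0 := by fun_prop
  have h1 := hd.tendsto_tube_of_nonneg hMc hfin hposcont hposc hposs fun x => le_max_right _ _
  have h2 := hd.tendsto_tube_of_nonneg hMc hfin hnegcont hnegc hnegs fun x => le_max_right _ _
  have hdec : ∀ x, max (h x) 0 - max (-h x) 0 = h x := fun x => by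
    rcases le_total 0 (h x) with hx | hx <;> simp [hx]
  have h3 := h1.sub h2
  rw [← integral_sub (hposcont.integrable_of_hasCompactSupport hposc)
    (hnegcont.integrable_of_hasCompactSupport hnegc)] at h3
  simp only [hdec] at h3
  refine h3.congr fun n => ?_
  rw [← integral_sub (hd.integrable_tube_integrand hposcont hposc hposs n)
    (hd.integrable_tube_integrand hnegcont hnegc hnegs n)]
  simp only [← mul_sub, hdec]

end IsDefining

/-- The divergence associated with a derivative `A`, that is, its trace. -/
def divergence (A : E3 →L[ℝ] E3) : ℝ :=
  ∑ i : Fin 3, ⟪A (EuclideanSpace.single i 1), EuclideanSpace.single i 1⟫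

lemma divergence_add (A B : E3 →L[ℝ] E3) : divergence (A + B) = divergence A + divergence B := by
  simp [divergence, inner_add_left, Finset.sum_add_distrib]

lemma divergence_smul (c : ℝ) (A : E3 →L[ℝ] E3) : divergence (c • A) = c * divergence A := by
  simp only [divergence, smul_apply, real_inner_smul_left, Finset.mul_sum]

lemma divergence_smulRight (l : E3 →L[ℝ] ℝ) (v : E3) : divergence (l.smulRight v) = l v := by
  have hv : v = ∑ i : Fin 3, v i • (EuclideanSpace.single i (1 : ℝ) : E3) := by
    ext j
    simp [Finset.sum_apply, Pi.single_apply]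
  conv_rhs => rw [hv, map_sum]
  refine Finset.sum_congr rfl fun i _ => ?_
  simp [mul_comm, EuclideanSpace.inner_single_right]

lemma continuous_divergence : Continuous divergence := by
  unfold divergence
  fun_prop

/-- The divergence theorem for compactly supported vector fields on `ℝ³`. -/
lemma integral_divergence_eq_zero {Z : E3 → E3} (hZ : ContDiff ℝ 1 Z) (hc : HasCompactSupport Z)
    (μ : Measure E3) [μ.IsAddHaarMeasure] : ∫ x, divergence (fderiv ℝ Z x) ∂μ = 0 := by
  have hcont : ∀ v : E3, Continuous fun x => fderiv ℝ Z x v := fun v =>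
    (hZ.continuous_fderiv one_ne_zero).clm_apply continuous_const
  have hcs : ∀ v : E3, HasCompactSupport fun x => fderiv ℝ Z x v := fun v => hc.fderiv_apply ℝ v
  have hint : ∀ v w : E3, Integrable (fun x => ⟪v, fderiv ℝ Z x w⟫) μ := fun v w =>
    (continuous_const.inner (hcont w)).integrable_of_hasCompactSupport
      ((hcs w).comp_left (g := fun y => ⟪v, y⟫) (inner_zero_right _))
  have hzero : ∀ v w : E3, ∫ x, ⟪v, fderiv ℝ Z x w⟫ ∂μ = 0 := fun v w => by
    have h := integral_bilinear_fderiv_right_eq_neg_left_of_integrable (μ := μ)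
      (f := fun _ : E3 => v) (g := Z) (v := w) (B := innerSL ℝ) (by simp)
      (hint v w) ((continuous_const.inner hZ.continuous).integrable_of_hasCompactSupport
        (hc.comp_left (g := fun y => ⟪v, y⟫) (inner_zero_right _)))
      (fun x _ => differentiableAt_const v) (fun x _ => hZ.differentiable one_ne_zero x)
    exact h.trans (by simp)
  simp only [divergence, real_inner_comm (EuclideanSpace.single _ (1 : ℝ) : E3)]
  rw [integral_finsetSum _ fun i _ => hint _ _]
  simp [hzero]

lemma contDiffAt_gradient {f : E3 → ℝ} {x : E3} (hf : ContDiffAt ℝ (⊤ : ℕ∞) f x) :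
    ContDiffAt ℝ (⊤ : ℕ∞) (gradient f) x := by
  have h : ContDiffAt ℝ (⊤ : ℕ∞) (fderiv ℝ f) x := hf.fderiv_right (by simp)
  exact (InnerProductSpace.toDual ℝ E3).symm.contDiff.contDiffAt.comp x h

/-- The Hessian is symmetric, in terms of the gradient. -/
lemma inner_fderiv_gradient_comm {f : E3 → ℝ} {x : E3} (hf : ContDiffAt ℝ (⊤ : ℕ∞) f x)
    (v w : E3) : ⟪fderiv ℝ (gradient f) x v, w⟫ = ⟪fderiv ℝ (gradient f) x w, v⟫ := by
  have key : ∀ v w : E3, ⟪fderiv ℝ (gradient f) x v, w⟫ = fderiv ℝ (fderiv ℝ f) x v w := by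
    intro v w
    have hG := ((contDiffAt_gradient hf).differentiableAt (by simp)).hasFDerivAt
    have hF : HasFDerivAt (fderiv ℝ f) (fderiv ℝ (fderiv ℝ f) x) x :=
      ((hf.fderiv_right (m := 1) (by norm_cast)).differentiableAt
        one_ne_zero).hasFDerivAt
    have h1 := hG.inner ℝ (hasFDerivAt_const w x)
    have h2 := hF.clm_apply (hasFDerivAt_const w x)
    simp only [inner_gradient_eq_fderiv] at h1
    simpa using congrArg (fun L => L v) (h1.unique h2)
  rw [key, key]
  exact hf.isSymmSndFDerivAt (by simpa using by norm_cast) v w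

/-- The tangential divergence of the vector field `u • b`, minus its normal part, where `ν` is a
unit normal field. -/
def tangentialDiv (ν : E3 → E3) (b : E3) (u : E3 → ℝ) (x : E3) : ℝ :=
  fderiv ℝ u x (b - ⟪b, ν x⟫ • ν x) - u x * ⟪b, ν x⟫ * divergence (fderiv ℝ ν x)

lemma tangentialDiv_eq_zero {ν : E3 → E3} {b : E3} {u : E3 → ℝ} {x : E3} (hx : x ∉ tsupport u) :
    tangentialDiv ν b u x = 0 := by
  have h : fderiv ℝ u x = 0 :=
    image_eq_zero_of_notMem_tsupport fun h => hx (tsupport_fderiv_subset ℝ h)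
  simp [tangentialDiv, h, image_eq_zero_of_notMem_tsupport hx]

lemma tsupport_tangentialDiv_subset {ν : E3 → E3} {b : E3} {u : E3 → ℝ} :
    tsupport (tangentialDiv ν b u) ⊆ tsupport u :=
  closure_minimal (fun _ hx => by_contra fun h => hx (tangentialDiv_eq_zero h))
    (isClosed_tsupport u)

namespace IsDefining

variable {M : Set E3} {f : E3 → ℝ} {U : Set E3} (hd : IsDefining M f U) {ν : E3 → E3}
  (hν : ∀ x ∈ U, ν x = ‖gradient f x‖⁻¹ • gradient f x)

include hd

lemma contDiffAt {x : E3} (hx : x ∈ U) : ContDiffAt ℝ (⊤ : ℕ∞) f x :=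
  hd.contDiffOn.contDiffAt (hd.isOpen.mem_nhds hx)

lemma norm_gradient_pos {x : E3} (hx : x ∈ U) : 0 < ‖gradient f x‖ := by
  rw [norm_gradient_eq]
  exact norm_pos_iff.mpr (hd.fderiv_ne_zero x hx)

lemma contDiffAt_norm_gradient {x : E3} (hx : x ∈ U) :
    ContDiffAt ℝ (⊤ : ℕ∞) (fun y => ‖gradient f y‖) x :=
  (contDiffAt_gradient (hd.contDiffAt hx)).norm ℝ (norm_pos_iff.mp (hd.norm_gradient_pos hx))

include hν

lemma contDiffAt_normal {x : E3} (hx : x ∈ U) : ContDiffAt ℝ (⊤ : ℕ∞) ν x := by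
  refine (((hd.contDiffAt_norm_gradient hx).inv (hd.norm_gradient_pos hx).ne').smul
    (contDiffAt_gradient (hd.contDiffAt hx))).congr_of_eventuallyEq ?_
  filter_upwards [hd.isOpen.mem_nhds hx] with y hy using hν y hy

lemma gradient_eq {x : E3} (hx : x ∈ U) : gradient f x = ‖gradient f x‖ • ν x := by
  rw [hν x hx, smul_smul, mul_inv_cancel₀ (hd.norm_gradient_pos hx).ne', one_smul]

lemma inner_normal_self {x : E3} (hx : x ∈ U) : ⟪ν x, ν x⟫ = 1 := by
  rw [hν x hx, real_inner_smul_left, real_inner_smul_right, real_inner_self_eq_norm_sq]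
  have := (hd.norm_gradient_pos hx).ne'
  field_simp

lemma inner_fderiv_normal {x : E3} (hx : x ∈ U) (v : E3) : ⟪fderiv ℝ ν x v, ν x⟫ = 0 := by
  have hN := ((hd.contDiffAt_normal hν hx).differentiableAt (by simp)).hasFDerivAt
  have h1 := hN.inner ℝ hN
  have h2 : HasFDerivAt (fun y => ⟪ν y, ν y⟫) (0 : E3 →L[ℝ] ℝ) x := by
    refine (hasFDerivAt_const (1 : ℝ) x).congr_of_eventuallyEq ?_
    filter_upwards [hd.isOpen.mem_nhds hx] with y hy using hd.inner_normal_self hν hy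
  have h3 := congrArg (fun L => L v) (h1.unique h2)
  simp [real_inner_comm] at h3
  rw [real_inner_comm]
  linarith

/-- The tangential derivative of `‖∇f‖` is governed by the acceleration of the normal lines. -/
lemma fderiv_norm_gradient {x : E3} (hx : x ∈ U) {Y : E3} (hY : ⟪ν x, Y⟫ = 0) :
    fderiv ℝ (fun y => ‖gradient f y‖) x Y = ‖gradient f x‖ * ⟪fderiv ℝ ν x (ν x), Y⟫ := by
  have hN := ((hd.contDiffAt_normal hν hx).differentiableAt (by simp)).hasFDerivAt
  have hg := ((hd.contDiffAt_norm_gradient hx).differentiableAt (by simp)).hasFDerivAt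
  have hG : HasFDerivAt (gradient f) _ x := (hg.smul hN).congr_of_eventuallyEq <| by
    filter_upwards [hd.isOpen.mem_nhds hx] with y hy using hd.gradient_eq hν hy
  have hsymm := inner_fderiv_gradient_comm (hd.contDiffAt hx) Y (ν x)
  rw [hG.fderiv] at hsymm
  simpa only [add_apply, smul_apply, ContinuousLinearMap.smulRight_apply, inner_add_left,
    real_inner_smul_left, hd.inner_fderiv_normal hν hx, hd.inner_normal_self hν hx, hY,
    mul_zero, mul_one, zero_add, add_zero] using hsymm

/-- The Euclidean divergence of the tangential field `φ(f) ‖∇f‖ u (b - ⟪b, ν⟫ ν)`. -/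
lemma divergence_tube_field {x : E3} (hx : x ∈ U) {φ : ℝ → ℝ} (hφ : ContDiff ℝ (⊤ : ℕ∞) φ)
    (b : E3) {u : E3 → ℝ} (hu : ContDiff ℝ (⊤ : ℕ∞) u) :
    divergence (fderiv ℝ
      (fun y => (φ (f y) * (‖gradient f y‖ * u y)) • (b - ⟪b, ν y⟫ • ν y)) x) =
      φ (f x) * (‖fderiv ℝ f x‖ * tangentialDiv ν b u x) := by
  have hN := ((hd.contDiffAt_normal hν hx).differentiableAt (by simp)).hasFDerivAt
  have hg := ((hd.contDiffAt_norm_gradient hx).differentiableAt (by simp)).hasFDerivAt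
  have hf := ((hd.contDiffAt hx).differentiableAt (by simp)).hasFDerivAt
  have hu' := (hu.differentiable (by simp) x).hasFDerivAt
  have hφ' := ((hφ.differentiable (by simp) (f x)).hasDerivAt).comp_hasFDerivAt x hf
  have hY := (((hasFDerivAt_const b x).inner ℝ hN).smul hN).const_sub b
  have hZ := (hφ'.mul (hg.mul hu')).smul hY
  have hYν : ⟪ν x, b - ⟪b, ν x⟫ • ν x⟫ = 0 := by
    rw [inner_sub_right, real_inner_smul_right, hd.inner_normal_self hν hx, real_inner_comm]
    ring
  have hfY : fderiv ℝ f x (b - ⟪b, ν x⟫ • ν x) = 0 := by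
    rw [← inner_gradient_eq_fderiv, hd.gradient_eq hν hx, real_inner_smul_left, hYν, mul_zero]
  have hgY := hd.fderiv_norm_gradient hν hx hYν
  have hYb : ⟪fderiv ℝ ν x (ν x), b - ⟪b, ν x⟫ • ν x⟫ = ⟪b, fderiv ℝ ν x (ν x)⟫ := by
    rw [inner_sub_right, real_inner_smul_right, hd.inner_fderiv_normal hν hx, real_inner_comm]
    ring
  rw [hYb] at hgY
  refine (congrArg divergence hZ.fderiv).trans ?_
  rw [divergence_add, divergence_smul, divergence_smulRight, ← neg_one_smul ℝ, divergence_smul,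
    divergence_add, divergence_smul, divergence_smulRight]
  simp only [add_apply, smul_apply, smul_eq_mul, Pi.mul_apply, Pi.smul_apply', Function.comp_apply, hfY, hgY,
    tangentialDiv, ← norm_gradient_eq, ContinuousLinearMap.comp_apply,
    ContinuousLinearMap.prod_apply, fderivInnerCLM_apply, zero_apply, inner_zero_left]
  ring

end IsDefining
namespace IsDefining

variable {M : Set E3} {f : E3 → ℝ} {U : Set E3} (hd : IsDefining M f U) {ν : E3 → E3}
  (hν : ∀ x ∈ U, ν x = ‖gradient f x‖⁻¹ • gradient f x) {b : E3} {u : E3 → ℝ}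

include hd hν

lemma continuous_tangentialDiv (hu : ContDiff ℝ (⊤ : ℕ∞) u) (hs : tsupport u ⊆ U) :
    Continuous (tangentialDiv ν b u) := by
  refine continuous_of_tsupport fun x hx => ?_
  have hN := hd.contDiffAt_normal hν (hs (tsupport_tangentialDiv_subset hx))
  have hNc := hN.continuousAt
  have hDN : ContinuousAt (fderiv ℝ ν) x := (hN.fderiv_right (m := 0) (by norm_num)).continuousAt
  have hbν : ContinuousAt (fun y => ⟪b, ν y⟫) x := continuousAt_const.inner hNc
  exact ((hu.continuous_fderiv (by simp)).continuousAt.clm_apply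
    (continuousAt_const.sub (hbν.smul hNc))).sub
    ((hu.continuous.continuousAt.mul hbν).mul (continuous_divergence.continuousAt.comp hDN))

/-- The divergence theorem on a closed surface, for fields supported where the surface is given by
a defining function. -/
lemma integral_tangentialDiv_eq_zero (hMc : IsClosed M) (hfin : μH[2] M < ⊤)
    (hu : ContDiff ℝ (⊤ : ℕ∞) u) (hc : HasCompactSupport u) (hs : tsupport u ⊆ U) :
    ∫ x in M, tangentialDiv ν b u x ∂μH[2] = 0 := by
  have hlim := hd.tendsto_tube hMc hfin (hd.continuous_tangentialDiv hν (b := b) hu hs)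
    (hc.mono' (subset_closure.trans tsupport_tangentialDiv_subset))
    (tsupport_tangentialDiv_subset.trans hs)
  refine tendsto_nhds_unique hlim (tendsto_const_nhds.congr fun n => ?_)
  set Z : E3 → E3 := fun y =>
    (approxDelta n (f y) * (‖gradient f y‖ * u y)) • (b - ⟪b, ν y⟫ • ν y) with hZ
  have hnear : ∀ x, x ∉ tsupport u → Z =ᶠ[nhds x] fun _ => 0 := fun x hx => by
    filter_upwards [(isClosed_tsupport u).isOpen_compl.mem_nhds hx] with y hy
    simp [hZ, image_eq_zero_of_notMem_tsupport hy]
  have hZc : HasCompactSupport Z := hc.mono fun x hx hux => hx (by simp [hZ, hux])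
  have hZs : ContDiff ℝ 1 Z := contDiff_iff_contDiffAt.mpr fun x => by
    by_cases hx : x ∈ tsupport u
    · have hN := hd.contDiffAt_normal hν (hs hx)
      exact ((((contDiff_approxDelta n).contDiffAt.comp x (hd.contDiffAt (hs hx))).mul
        ((hd.contDiffAt_norm_gradient (hs hx)).mul hu.contDiffAt)).smul
        (contDiffAt_const.sub ((contDiffAt_const.inner ℝ hN).smul hN))).of_le (by norm_cast)
    · exact contDiffAt_const.congr_of_eventuallyEq (hnear x hx)
  rw [← integral_divergence_eq_zero hZs hZc sliceMeasure]
  refine integral_congr_ae (Filter.Eventually.of_forall fun x => ?_)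
  by_cases hx : x ∈ tsupport u
  · exact hd.divergence_tube_field hν (hs hx) (contDiff_approxDelta n) b hu
  · simp only [(hnear x hx).fderiv_eq, tangentialDiv_eq_zero hx]
    simp [divergence]

end IsDefining

namespace Surface3

variable (S : Surface3)

lemma exists_isDefining {p : E3} (hp : p ∈ S.carrier) : ∃ (U : Set E3) (f : E3 → ℝ),
    p ∈ U ∧ IsDefining S.carrier f U ∧ ∀ x ∈ U, S.ν x = ‖gradient f x‖⁻¹ • gradient f x := by
  obtain ⟨U, hU, hpU, f, hf, hM, hg⟩ := S.localDef p hp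
  refine ⟨U, f, hpU, ⟨hU, hf, hM, fun x hx h0 => (hg x hx).1 ?_⟩, fun x hx => (hg x hx).2⟩
  rw [← norm_eq_zero, norm_gradient_eq, h0, norm_zero]

lemma inner_normal_self {p : E3} (hp : p ∈ S.carrier) : ⟪S.ν p, S.ν p⟫ = 1 := by
  obtain ⟨U, f, hpU, hd, hν⟩ := S.exists_isDefining hp
  exact hd.inner_normal_self hν hpU

lemma exists_chart {p : E3} (hp : p ∈ S.carrier) : ∃ (f : E3 → ℝ) (C : FlatChart f 2),
    p ∈ C.Φ.source ∧ ∀ x ∈ C.Φ.source, (x ∈ S.carrier ↔ f x = 0) := by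
  obtain ⟨U, f, hpU, hd, -⟩ := S.exists_isDefining hp
  obtain ⟨C, hpC, hCU⟩ := exists_flatChart hd.isOpen hd.contDiffOn hpU (hd.fderiv_ne_zero p hpU)
    one_lt_two
  exact ⟨f, C, hpC, fun x hx => hd.mem_iff x (hCU hx)⟩

lemma measure_lt_top (hcpt : IsCompact S.carrier) : (μH[2] : Measure E3) S.carrier < ⊤ :=
  hcpt.measure_lt_top_of_nhdsWithin fun _ hp => by
    obtain ⟨f, C, hpC, hM⟩ := S.exists_chart hp
    exact C.finiteAtFilter_nhdsWithin hM hpC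

lemma measure_inter_pos {p : E3} (hp : p ∈ S.carrier) {O : Set E3} (hO : IsOpen O) (hpO : p ∈ O) :
    0 < (μH[2] : Measure E3) (S.carrier ∩ O) := by
  obtain ⟨f, C, hpC, hM⟩ := S.exists_chart hp
  exact C.measure_inter_pos hM hpC hp hO hpO

/-- The divergence theorem on a compact surface. -/
lemma integral_tangentialDiv_eq_zero (hcpt : IsCompact S.carrier) (b : E3) {w : E3 → ℝ}
    (hw : ContDiff ℝ (⊤ : ℕ∞) w) : ∫ x in S.carrier, tangentialDiv S.ν b w x ∂μH[2] = 0 := by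
  have hfin := S.measure_lt_top hcpt
  have : IsFiniteMeasure ((μH[2] : Measure E3).restrict S.carrier) := ⟨by simpa using hfin⟩
  choose! U f hpU hd hν using fun p (hp : p ∈ S.carrier) => S.exists_isDefining hp
  obtain ⟨t, φ, hφ, hsum⟩ := exists_finite_smooth_partition hcpt (fun p hp => (hd p hp).isOpen) hpU
  have hs : ∀ i, tsupport (fun x => φ i x * w x) ⊆ U i := fun i =>
    tsupport_mul_subset_left.trans (hφ i).2.2.2.1
  have hu : ∀ i, ContDiff ℝ (⊤ : ℕ∞) fun x => φ i x * w x := fun i => (hφ i).2.1.mul hw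
  have hc : ∀ i, HasCompactSupport fun x => φ i x * w x := fun i => (hφ i).2.2.1.mul_right
  have hzero : ∀ i, ∫ x in S.carrier, tangentialDiv S.ν b (fun x => φ i x * w x) x ∂μH[2] = 0 :=
    fun i => (hd i (hφ i).1).integral_tangentialDiv_eq_zero (hν i (hφ i).1) hcpt.isClosed hfin
      (hu i) (hc i) (hs i)
  have hint : ∀ i, IntegrableOn (tangentialDiv S.ν b fun x => φ i x * w x) S.carrier μH[2] :=
    fun i => ((hd i (hφ i).1).continuous_tangentialDiv (hν i (hφ i).1) (hu i)
      (hs i)).integrable_of_hasCompactSupport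
      ((hc i).mono' (subset_closure.trans tsupport_tangentialDiv_subset))
  have hdecomp : ∀ x ∈ S.carrier,
      tangentialDiv S.ν b w x = ∑ i, tangentialDiv S.ν b (fun x => φ i x * w x) x := by
    intro x hx
    have hev : w =ᶠ[nhds x] fun y => ∑ i, φ i y * w y := by
      filter_upwards [hsum x hx] with y hy
      rw [← Finset.sum_mul, hy, one_mul]
    have hfd : fderiv ℝ w x = ∑ i, fderiv ℝ (fun y => φ i y * w y) x := by
      rw [hev.fderiv_eq]
      exact fderiv_fun_sum fun i _ => (hu i).differentiable (by simp) x
    simp only [tangentialDiv, Finset.sum_sub_distrib, ← Finset.sum_mul, hfd, sum_apply]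
    rw [(hsum x hx).self_of_nhds, one_mul]
  rw [setIntegral_congr_fun hcpt.measurableSet hdecomp, integral_finsetSum _ fun i _ => hint i]
  simp [hzero]

end Surface3

lemma hasFDerivAt_gaussian (x : E3) : HasFDerivAt (fun y : E3 => Real.exp (-‖y‖ ^ 2 / 4))
    (Real.exp (-‖x‖ ^ 2 / 4) • (-(1 / 2 : ℝ)) • innerSL ℝ x) x := by
  have h1 : HasFDerivAt (fun y : E3 => -‖y‖ ^ 2 / 4) ((-(1 / 2 : ℝ)) • innerSL ℝ x) x := by
    refine (((hasStrictFDerivAt_norm_sq x).hasFDerivAt.const_mul (-(1 / 4) : ℝ)).congr_fderiv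
      ?_).congr_of_eventuallyEq (Filter.Eventually.of_forall fun y => ?_)
    · ext v; simp; ring
    · simp only; ring
  exact h1.exp

/-- On a self-shrinker, the tangential divergence of the Gaussian times `b` is a multiple of the
first moment density. -/
lemma tangentialDiv_gaussian {S : Surface3} (hS : IsShrinker S) (b : E3) {x : E3}
    (hx : x ∈ S.carrier) : tangentialDiv S.ν b (fun y => Real.exp (-‖y‖ ^ 2 / 4)) x =
      -(1 / 2) * (Real.exp (-‖x‖ ^ 2 / 4) * ⟪b, x⟫) := by
  have hH : divergence (fderiv ℝ S.ν x) = 1 / 2 * ⟪x, S.ν x⟫ := hS x hx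
  rw [tangentialDiv, (hasFDerivAt_gaussian x).fderiv, hH]
  simp only [smul_apply, smul_eq_mul, innerSL_apply_apply, inner_sub_right, real_inner_smul_right]
  rw [real_inner_comm x b]
  ring

/-- For a compact self-shrinker `M ⊂ ℝ³`, `∫_M e^{-|x|²/4} ⟨b,x⟩ dA = 0` for every
`b ∈ ℝ³`; consequently `M` cannot lie strictly on one side of a plane through the
origin: if `⟨b,x⟩ ≥ 0` on `M` then `⟨b,x⟩ = 0` on `M`. -/
theorem shrinker_first_moment_vanishes
    (S : Surface3) (hS : IsShrinker S) (hcpt : IsCompact S.carrier) (b : E3) :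
    (∫ x in S.carrier, Real.exp (-‖x‖ ^ 2 / 4) * ⟪b, x⟫ ∂μH[2]) = 0 ∧
    ((∀ x ∈ S.carrier, 0 ≤ ⟪b, x⟫) → ∀ x ∈ S.carrier, ⟪b, x⟫ = 0) := by
  have hfin := S.measure_lt_top hcpt
  have hw : ContDiff ℝ (⊤ : ℕ∞) fun y : E3 => Real.exp (-‖y‖ ^ 2 / 4) :=
    ((contDiff_norm_sq ℝ).neg.div_const 4).exp
  have hI : (∫ x in S.carrier, Real.exp (-‖x‖ ^ 2 / 4) * ⟪b, x⟫ ∂μH[2]) = 0 := by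
    have h := S.integral_tangentialDiv_eq_zero hcpt b hw
    rw [setIntegral_congr_fun hcpt.measurableSet fun x hx => tangentialDiv_gaussian hS b hx,
      integral_const_mul] at h
    linarith
  refine ⟨hI, fun hb q hq => by_contra fun hne => ?_⟩
  have hcont : Continuous fun x : E3 => Real.exp (-‖x‖ ^ 2 / 4) * ⟪b, x⟫ := by fun_prop
  have hint : IntegrableOn (fun x : E3 => Real.exp (-‖x‖ ^ 2 / 4) * ⟪b, x⟫) S.carrier μH[2] :=
    hcont.continuousOn.integrableOn_of_subset_isCompact hcpt hcpt.measurableSet le_rfl hfin.ne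
  have hO : IsOpen {x : E3 | 0 < ⟪b, x⟫} := isOpen_lt continuous_const (by fun_prop)
  have hpos := S.measure_inter_pos hq hO ((hb q hq).lt_of_ne' hne)
  have hnn : 0 ≤ᵐ[μH[2].restrict S.carrier] fun x : E3 => Real.exp (-‖x‖ ^ 2 / 4) * ⟪b, x⟫ :=
    ae_restrict_of_forall_mem hcpt.measurableSet fun x hx =>
      mul_nonneg (Real.exp_pos _).le (hb x hx)
  refine ((setIntegral_pos_iff_support_of_nonneg_ae hnn hint).mpr
    (hpos.trans_le (measure_mono fun x hx => ⟨?_, hx.1⟩))).ne' hI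
  exact (mul_pos (Real.exp_pos _) hx.2).ne'
end
end
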